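/- arXiv:1905.04991 — 9 statements merged into one kernel-verified Lean document; each statement's English description precedes it below -/
import Mathlib

section
/- Let K0 ⊆ K1 and K0 ⊆ K2 be field extensions, and for i = 0, 1, 2 let O_i be a valuation subring of K_i such that O_1 ∩ K0 = O_0 and O_2 ∩ K0 = O_0. Then the natural ring homomorphism O_1 ⊗_{O_0} O_2 → K_1 ⊗_{K_0} K_2 (induced by the inclusions O_i ⊆ K_i) is injective. -/
open TensorProduct

universe u

variable {K L : Type*} [Field K] [Field L]

def vincl (f : K →+* L) (O : ValuationSubring K) (O' : ValuationSubring L)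
    (h : O'.comap f = O) : ↥O →+* ↥O' where
  toFun x := ⟨f x, by
      have hx : (x : K) ∈ O'.comap f := h ▸ x.2
      exact ValuationSubring.mem_comap.mp hx⟩
  map_one' := by ext; simp
  map_mul' x y := by ext; simp
  map_zero' := by ext; simp
  map_add' x y := by ext; simp

theorem tensorProduct_hom_injective_of_valuationRing {R K A B L M : Type*} [CommRing R] [IsDomain R]
    [ValuationRing R] [Field K] [Algebra R K] [IsFractionRing R K] [CommRing A] [CommRing B]
    [Algebra R A] [Algebra R B] [Field L] [Field M] [Algebra K L] [Algebra K M]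
    (i : A →+* L) (j : B →+* M) (hi : Function.Injective i) (hj : Function.Injective j)
    (hiR : ∀ r : R, i (algebraMap R A r) = algebraMap K L (algebraMap R K r))
    (hjR : ∀ r : R, j (algebraMap R B r) = algebraMap K M (algebraMap R K r))
    (F : A ⊗[R] B →+* L ⊗[K] M) (hF : ∀ x y, F (x ⊗ₜ[R] y) = i x ⊗ₜ[K] j y) :
    Function.Injective F := by
  let : Algebra R L := ((algebraMap K L).comp (algebraMap R K)).toAlgebra
  let : Algebra R M := ((algebraMap K M).comp (algebraMap R K)).toAlgebra
  have : IsScalarTower R K L := .of_algebraMap_eq' rfl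
  have : IsScalarTower R K M := .of_algebraMap_eq' rfl
  let f : A →ₐ[R] L := { i with commutes' := hiR }
  let g : B →ₐ[R] M := { j with commutes' := hjR }
  have hL : Function.Injective (algebraMap R L) :=
    (algebraMap K L).injective.comp (IsFractionRing.injective R K)
  have : FaithfulSMul R L := (faithfulSMul_iff_algebraMap_injective R L).mpr hL
  have : Module.IsTorsionFree R L := inferInstance
  have hM : Function.Injective (algebraMap R M) :=
    (algebraMap K M).injective.comp (IsFractionRing.injective R K)
  have : FaithfulSMul R M := (faithfulSMul_iff_algebraMap_injective R M).mpr hM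
  have : Module.IsTorsionFree R M := inferInstance
  have : Module.IsTorsionFree R B := hj.moduleIsTorsionFree g (map_smul g)
  have : Module.Flat R L := Module.Flat.flat_iff_torsion_eq_bot_of_isBezout.mpr
    (Submodule.isTorsionFree_iff_torsion_eq_bot.mp inferInstance)
  have : Module.Flat R B := Module.Flat.flat_iff_torsion_eq_bot_of_isBezout.mpr
    (Submodule.isTorsionFree_iff_torsion_eq_bot.mp inferInstance)
  let e := IsLocalization.moduleTensorEquiv (nonZeroDivisors R) K L M
  have hmap := TensorProduct.map_injective_of_flat_flat f.toLinearMap g.toLinearMap hi hj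
  have key : ∀ z, e (F z) = TensorProduct.map f.toLinearMap g.toLinearMap z := by
    intro z
    induction z with
    | zero => simp
    | add x y hx hy => rw [map_add, map_add, map_add, hx, hy]
    | tmul x y => rw [hF]; rfl
  intro x y hxy
  apply hmap
  rw [← key, ← key, hxy]

theorem stmt0 {K0 K1 K2 : Type u} [Field K0] [Field K1] [Field K2]
    [Algebra K0 K1] [Algebra K0 K2]
    (O0 : ValuationSubring K0) (O1 : ValuationSubring K1) (O2 : ValuationSubring K2)
    (h1 : O1.comap (algebraMap K0 K1) = O0) (h2 : O2.comap (algebraMap K0 K2) = O0) :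
    letI : Algebra ↥O0 ↥O1 := (vincl (algebraMap K0 K1) O0 O1 h1).toAlgebra
    letI : Algebra ↥O0 ↥O2 := (vincl (algebraMap K0 K2) O0 O2 h2).toAlgebra
    ∀ F : (↥O1 ⊗[↥O0] ↥O2) →+* (K1 ⊗[K0] K2),
      (∀ (x : ↥O1) (y : ↥O2), F (x ⊗ₜ[↥O0] y) = (x : K1) ⊗ₜ[K0] (y : K2)) →
      Function.Injective F := by
  intro F hF
  let : Algebra O0 O1 := (vincl (algebraMap K0 K1) O0 O1 h1).toAlgebra
  let : Algebra O0 O2 := (vincl (algebraMap K0 K2) O0 O2 h2).toAlgebra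
  exact tensorProduct_hom_injective_of_valuationRing (K := K0) O1.subtype O2.subtype
    Subtype.val_injective Subtype.val_injective (fun _ ↦ rfl) (fun _ ↦ rfl) F hF
end

section
/- Let L/K be a normal algebraic field extension and let O be a valuation subring of K. If O1 and O2 are valuation subrings of L with O1 ∩ K = O2 ∩ K = O, then there exists a K-algebra automorphism σ of L such that σ(O1) = O2. In other words, the group of K-algebra automorphisms of L acts transitively on the set of valuation subrings of L extending O. -/
universe u

open scoped Pointwise

namespace ValuationSubring

variable {K L : Type*} [Field K] [Field L] [Algebra K L]

theorem isIntegral_of_forall_mem {A : ValuationSubring K} {x : L}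
    (h : ∀ V : ValuationSubring L, (∀ a ∈ A, algebraMap K L a ∈ V) → x ∈ V) : IsIntegral A x := by
  by_contra hx
  have : IsIntegrallyClosedIn (integralClosure A L).toSubring L :=
    inferInstanceAs (IsIntegrallyClosedIn (integralClosure A L) L)
  obtain ⟨V, hV, hxV⟩ := Subring.exists_le_valuationSubring_of_isIntegrallyClosedIn
    (R := (integralClosure A L).toSubring) (x := x) hx
  exact hxV (h V fun a ha ↦ hV (algebraMap_mem (integralClosure A L) (⟨a, ha⟩ : A)))

theorem mem_of_isIntegral {A : ValuationSubring K} {V : ValuationSubring L}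
    (hV : ∀ a ∈ A, algebraMap K L a ∈ V) {x : L} (hx : IsIntegral A x) : x ∈ V := by
  let f : A →+* V := ((algebraMap K L).comp A.subtype).codRestrict V fun a ↦ hV a a.2
  have hx' : IsIntegral V x := by
    obtain ⟨p, hp, hpx⟩ := hx
    refine ⟨p.map f, hp.map f, ?_⟩
    rw [Polynomial.eval₂_map]
    exact hpx
  obtain ⟨y, rfl⟩ := IsIntegrallyClosed.isIntegral_iff.mp hx'
  exact y.2

theorem algebraMap_mem_nonunits_iff {A : ValuationSubring K} {V : ValuationSubring L}
    (hV : V.comap (algebraMap K L) = A) {x : K} :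
    algebraMap K L x ∈ V.nonunits ↔ x ∈ A.nonunits := by
  subst hV
  simp [mem_nonunits_iff_or]

/-- An element algebraic over `K` satisfies a polynomial relation whose coefficients lie in the
valuation subring `A`, one of them being `1` and all later ones being nonunits. -/
theorem exists_sum_eq_zero_of_isAlgebraic (A : ValuationSubring K) {x : L}
    (hx : IsAlgebraic K x) :
    ∃ (s : Finset ℕ) (j : ℕ) (c : ℕ → K), j ∈ s ∧ c j = 1 ∧ (∀ i, i ∈ s → c i ∈ A) ∧
      (∀ i, i ∈ s → j < i → c i ∈ A.nonunits) ∧ ∑ i ∈ s, algebraMap K L (c i) * x ^ i = 0 := by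
  obtain ⟨p, hp0, hp⟩ := hx
  obtain ⟨j, hj, hmax⟩ := p.support.exists_max_image
    (fun i ↦ toLex (A.valuation (p.coeff i), i)) (Polynomial.support_nonempty.mpr hp0)
  have hj0 : p.coeff j ≠ 0 := Polynomial.mem_support_iff.mp hj
  have hpos : 0 < A.valuation (p.coeff j) := A.valuation.pos_iff.mpr hj0
  refine ⟨p.support, j, fun i ↦ p.coeff i / p.coeff j, hj, div_self hj0, fun i hi ↦ ?_,
    fun i hi hji ↦ ?_, ?_⟩
  · rw [← valuation_le_one_iff, map_div₀, div_le_one₀ hpos]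
    rcases Prod.Lex.toLex_le_toLex.mp (hmax i hi) with h | h
    exacts [h.le, h.1.le]
  · rw [mem_nonunits_iff, map_div₀, div_lt_one₀ hpos]
    rcases Prod.Lex.toLex_le_toLex.mp (hmax i hi) with h | h
    exacts [h, absurd h.2 hji.not_ge]
  · have : ∑ i ∈ p.support, algebraMap K L (p.coeff i) * x ^ i = 0 := by
      rw [← hp, Polynomial.aeval_def, Polynomial.eval₂_eq_sum, Polynomial.sum]
    simp_rw [map_div₀, div_mul_eq_mul_div, ← Finset.sum_div, this, zero_div]

/-- A valuation subring of an algebraic extension is determined by its center on the integral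
closure of its restriction to the base field. -/
theorem le_of_isIntegral_mem_nonunits [Algebra.IsAlgebraic K L] {A : ValuationSubring K}
    {V W : ValuationSubring L} (hV : V.comap (algebraMap K L) = A)
    (hW : W.comap (algebraMap K L) = A)
    (h : ∀ b : L, IsIntegral A b → b ∈ W.nonunits → b ∈ V.nonunits) : V ≤ W := by
  intro x hx
  obtain rfl | hx0 := eq_or_ne x 0
  · exact W.zero_mem
  obtain ⟨s, j, c, hj, hcj, hcA, hcn, hsum⟩ :=
    A.exists_sum_eq_zero_of_isAlgebraic (Algebra.IsAlgebraic.isAlgebraic (R := K) x)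
  set b : L := ∑ i ∈ s with j ≤ i, algebraMap K L (c i) * x ^ (i - j) with hb
  set d : L := ∑ i ∈ s with ¬ j ≤ i, algebraMap K L (c i) * x⁻¹ ^ (j - 1 - i) with hd
  have hrel : x * b + d = 0 := by
    have : x * b + d = x * x⁻¹ ^ j * ∑ i ∈ s, algebraMap K L (c i) * x ^ i := by
      rw [← Finset.sum_filter_add_sum_filter_not s (j ≤ ·), mul_add, hb, hd, Finset.mul_sum,
        Finset.mul_sum, Finset.mul_sum]
      congr 1
      · refine Finset.sum_congr rfl fun i hi ↦ ?_
        obtain ⟨k, rfl⟩ := Nat.exists_eq_add_of_le (Finset.mem_filter.mp hi).2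
        rw [Nat.add_sub_cancel_left, pow_add, inv_pow]
        field_simp
      · refine Finset.sum_congr rfl fun i hi ↦ ?_
        obtain ⟨k, rfl⟩ := Nat.exists_eq_add_of_lt (not_le.mp (Finset.mem_filter.mp hi).2)
        rw [show i + k + 1 - 1 - i = k by omega, inv_pow, inv_pow, pow_add, pow_add]
        field_simp
    rw [this, hsum, mul_zero]
  have hbmem {U : ValuationSubring L} (hU : ∀ a ∈ A, algebraMap K L a ∈ U) (hxU : x ∈ U) :
      b ∈ U :=
    sum_mem fun i hi ↦ U.mul_mem _ _ (hU _ (hcA i (Finset.mem_filter.mp hi).1)) (pow_mem hxU _)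
  have hdmem {U : ValuationSubring L} (hU : ∀ a ∈ A, algebraMap K L a ∈ U) (hxU : x⁻¹ ∈ U) :
      d ∈ U :=
    sum_mem fun i hi ↦ U.mul_mem _ _ (hU _ (hcA i (Finset.mem_filter.mp hi).1)) (pow_mem hxU _)
  have hd_eq : d = -(x * b) := eq_neg_of_add_eq_zero_right hrel
  have hb_eq : b = -(x⁻¹ * d) := by rw [hd_eq]; field_simp
  have hb_int : IsIntegral A b := isIntegral_of_forall_mem fun U hU ↦ by
    rcases U.mem_or_inv_mem x with hxU | hxU
    · exact hbmem hU hxU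
    · rw [hb_eq]; exact U.neg_mem _ (U.mul_mem _ _ hxU (hdmem hU hxU))
  have hd_int : IsIntegral A d := isIntegral_of_forall_mem fun U hU ↦ by
    rcases U.mem_or_inv_mem x with hxU | hxU
    · rw [hd_eq]; exact U.neg_mem _ (U.mul_mem _ _ hxU (hbmem hU hxU))
    · exact hdmem hU hxU
  have hbV : V.valuation b = 1 := by
    have hjs : j ∈ s.filter (j ≤ ·) := Finset.mem_filter.mpr ⟨hj, le_rfl⟩
    rw [hb, ← Finset.add_sum_erase _ _ hjs, hcj, Nat.sub_self, pow_zero, map_one, mul_one]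
    refine V.valuation.map_one_add_of_lt (V.valuation.map_sum_lt one_ne_zero fun i hi ↦ ?_)
    obtain ⟨hij, hi⟩ := Finset.mem_erase.mp hi
    obtain ⟨his, hi⟩ := Finset.mem_filter.mp hi
    have h1 : V.valuation (algebraMap K L (c i)) < 1 :=
      (algebraMap_mem_nonunits_iff hV).mpr (hcn i his (lt_of_le_of_ne hi hij.symm))
    rw [map_mul]
    exact mul_lt_one_of_lt_of_le h1 ((V.valuation_le_one_iff _).mpr (pow_mem hx _))
  have hAW : ∀ a ∈ A, algebraMap K L a ∈ W := fun a ha ↦ by rwa [← hW] at ha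
  have hb0 : b ≠ 0 := fun h0 ↦ by simp [h0] at hbV
  have hbW : b⁻¹ ∈ W := by
    by_contra hbW
    exact hbV.not_lt (h b hb_int (W.mem_nonunits_iff_or.mpr (.inr hbW)))
  have : x = -(d * b⁻¹) := by rw [hd_eq]; field_simp
  rw [this]
  exact W.neg_mem _ (W.mul_mem _ _ (mem_of_isIntegral hAW hd_int) hbW)

/-- The center of `V` on the integral closure of a valuation subring `A` contained in it. -/
def center (A : ValuationSubring K) (V : ValuationSubring L)
    (hV : ∀ a ∈ A, algebraMap K L a ∈ V) : Ideal (integralClosure A L) :=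
  (IsLocalRing.maximalIdeal V).comap
    ((integralClosure A L).val.toRingHom.codRestrict V fun b ↦ mem_of_isIntegral hV b.2)

instance (A : ValuationSubring K) (V : ValuationSubring L)
    (hV : ∀ a ∈ A, algebraMap K L a ∈ V) : (center A V hV).IsPrime :=
  Ideal.IsPrime.comap _

theorem mem_center {A : ValuationSubring K} {V : ValuationSubring L}
    {hV : ∀ a ∈ A, algebraMap K L a ∈ V} {b : integralClosure A L} :
    b ∈ center A V hV ↔ (b : L) ∈ V.nonunits :=
  coe_mem_nonunits_iff.symm

instance isInvariant_integralClosure [IsGalois K L] (A : ValuationSubring K) :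
    Algebra.IsInvariant A (integralClosure A L) Gal(L/K) where
  isInvariant b hb := by
    obtain ⟨a, ha⟩ := (InfiniteGalois.mem_range_algebraMap_iff_fixed (b : L)).mpr
      fun g ↦ congrArg Subtype.val (hb g)
    have hint : IsIntegral A a := by
      rw [← isIntegral_algebraMap_iff (algebraMap K L).injective, ha]
      exact b.2
    obtain ⟨y, rfl⟩ := IsIntegrallyClosed.isIntegral_iff.mp hint
    exact ⟨y, Subtype.ext ha⟩

theorem exists_algEquiv_of_isGalois [IsGalois K L] {V W : ValuationSubring L}
    (h : V.comap (algebraMap K L) = W.comap (algebraMap K L)) :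
    ∃ σ : Gal(L/K), ∀ x : L, σ x ∈ W ↔ x ∈ V := by
  generalize hA : W.comap (algebraMap K L) = A at h
  have hAV : ∀ a ∈ A, algebraMap K L a ∈ V := fun a ha ↦ by rwa [← h] at ha
  have hAW : ∀ a ∈ A, algebraMap K L a ∈ W := fun a ha ↦ by rwa [← hA] at ha
  let _ : TopologicalSpace (integralClosure A L) := ⊥
  have : DiscreteTopology (integralClosure A L) := ⟨rfl⟩
  have : ContinuousSMul Gal(L/K) (integralClosure A L) :=
    continuousSMul_iff_stabilizer_isOpen.mpr fun b ↦ by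
      convert stabilizer_isOpen_of_isIntegral (K := K) (b : L) using 2
      ext g
      exact Subtype.ext_iff
  obtain ⟨σ, hσ⟩ := Algebra.IsInvariant.exists_smul_of_under_eq_of_profinite (A := A)
    (G := Gal(L/K)) (center A V hAV) (center A W hAW) <| by
      ext a
      change _ ∈ center A V hAV ↔ _ ∈ center A W hAW
      rw [mem_center, mem_center]
      exact (algebraMap_mem_nonunits_iff h).trans (algebraMap_mem_nonunits_iff hA).symm
  have hcenter (b : L) (hb : IsIntegral A b) : σ b ∈ W.nonunits ↔ b ∈ V.nonunits := by
    have := Ideal.smul_mem_pointwise_smul_iff (a := σ) (S := center A V hAV)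
      (x := (⟨b, hb⟩ : integralClosure A L))
    rwa [← hσ, mem_center, mem_center] at this
  have hWσ : (W.comap (σ : L →+* L)).comap (algebraMap K L) = A := by
    rw [comap_comap, ← hA]
    congr 1
    ext; simp
  have hn (b : L) : b ∈ (W.comap (σ : L →+* L)).nonunits ↔ σ b ∈ W.nonunits := by
    simp [mem_nonunits_iff_or]
  have : W.comap (σ : L →+* L) = V := le_antisymm
    (le_of_isIntegral_mem_nonunits hWσ h fun b hb hbV ↦ (hn b).mpr ((hcenter b hb).mpr hbV))
    (le_of_isIntegral_mem_nonunits h hWσ fun b hb hbV ↦ (hcenter b hb).mp ((hn b).mp hbV))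
  exact ⟨σ, fun x ↦ by rw [← this]; rfl⟩

theorem pow_mem_iff (V : ValuationSubring L) {x : L} {n : ℕ} (hn : n ≠ 0) :
    x ^ n ∈ V ↔ x ∈ V := by
  rw [← valuation_le_one_iff, ← valuation_le_one_iff, map_pow, pow_le_one_iff hn]

end ValuationSubring

/-- For a normal algebraic extension `L/K`, the group of `K`-algebra
automorphisms of `L` acts transitively on the valuation subrings of `L` extending a given
valuation subring `O` of `K`. -/
theorem stmt4 {K L : Type u} [Field K] [Field L] [Algebra K L] [Normal K L]
    (O : ValuationSubring K) (O1 O2 : ValuationSubring L)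
    (h1 : O1.comap (algebraMap K L) = O) (h2 : O2.comap (algebraMap K L) = O) :
    ∃ σ : L ≃ₐ[K] L, ∀ x : L, σ x ∈ O2 ↔ x ∈ O1 := by
  let E := separableClosure K L
  obtain ⟨τ, hτ⟩ := ValuationSubring.exists_algEquiv_of_isGalois (K := K) (L := E)
    (V := O1.comap (algebraMap E L)) (W := O2.comap (algebraMap E L)) <| by
      rw [ValuationSubring.comap_comap, ValuationSubring.comap_comap,
        ← IsScalarTower.algebraMap_eq, h1, h2]
  refine ⟨τ.liftNormal L, fun x ↦ ?_⟩
  obtain ⟨n, y, hy⟩ := IsPurelyInseparable.pow_mem E (ringExpChar E) x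
  have hq : ringExpChar E ^ n ≠ 0 := pow_ne_zero n (expChar_ne_zero E (ringExpChar E))
  rw [← O1.pow_mem_iff hq, ← O2.pow_mem_iff hq, ← map_pow, ← hy, AlgEquiv.liftNormal_commutes]
  exact hτ y
end

section
/- Let K1 ⊆ K2 ⊆ L2 and K1 ⊆ L1 ⊆ L2 be towers of fields such that K2/K1 and L2/L1 are finite normal extensions and K1 is relatively algebraically closed in L1. Then the restriction map from the group of L1-algebra automorphisms of L2 to the group of K1-algebra automorphisms of K2 is well defined and surjective: every L1-algebra automorphism τ of L2 satisfies τ(K2) = K2, and for every K1-algebra automorphism σ of K2 there exists an L1-algebra automorphism τ of L2 with τ|_{K2} = σ. -/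
universe u

/-- A ring homomorphism `f : A →+* B` is relatively algebraically closed if every element
of `B` which is algebraic over the image of `A` lies in the image of `A`. -/
def RelAlgClosed {A B : Type*} [CommRing A] [CommRing B] (f : A →+* B) : Prop :=
  ∀ x : B, (∃ p : Polynomial A, p ≠ 0 ∧ Polynomial.eval₂ f x p = 0) → x ∈ Set.range f

/-- In a normal extension, an element fixed by all automorphisms is purely inseparable over the
base. -/
theorem mem_perfectClosure_of_forall_algEquiv_eq {F E : Type*} [Field F] [Field E] [Algebra F E]
    [Normal F E] {x : E} (hx : ∀ τ : E ≃ₐ[F] E, τ x = x) : x ∈ perfectClosure F E := by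
  classical
  have hxint : IsIntegral F x := Normal.isIntegral ‹_› x
  rw [mem_perfectClosure_iff_natSepDegree_eq_one,
    Polynomial.natSepDegree_eq_of_splits _ (Normal.splits ‹_› x), Finset.card_eq_one]
  refine ⟨x, Finset.ext fun y ↦ ?_⟩
  rw [Multiset.mem_toFinset, Polynomial.mem_aroots, Finset.mem_singleton]
  constructor
  · rintro ⟨-, hy⟩
    obtain ⟨τ, hτ⟩ := minpoly.exists_algEquiv_of_root' hxint.isAlgebraic hy
    rw [← hτ, hx]
  · rintro rfl
    exact ⟨minpoly.ne_zero hxint, minpoly.aeval F y⟩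

/-- Automorphisms over the base fix purely inseparable elements. -/
theorem algEquiv_apply_eq_of_mem_perfectClosure {F E : Type*} [Field F] [Field E] [Algebra F E]
    {x : E} (hx : x ∈ perfectClosure F E) (σ : E ≃ₐ[F] E) : σ x = x := by
  obtain ⟨n, y, hy⟩ := mem_perfectClosure_iff.1 hx
  have : ExpChar E (ringExpChar F) := expChar_of_injective_algebraMap (algebraMap F E).injective _
  apply iterateFrobenius_inj E (ringExpChar F) n
  rw [iterateFrobenius_def, iterateFrobenius_def, ← map_pow, ← hy, σ.commutes]

/-- If `K1` is relatively algebraically closed in `L1`, then an element of `K2` that is purely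
inseparable over `L1` is purely inseparable over `K1`. -/
theorem RelAlgClosed.mem_perfectClosure {K1 K2 L1 L2 : Type*} [Field K1] [Field K2] [Field L1]
    [Field L2] [Algebra K1 K2] [Algebra K2 L2] [Algebra K1 L1] [Algebra L1 L2] [Algebra K1 L2]
    [IsScalarTower K1 K2 L2] [IsScalarTower K1 L1 L2] [Algebra.IsAlgebraic K1 K2]
    (hrac : RelAlgClosed (algebraMap K1 L1)) {x : K2}
    (hx : algebraMap K2 L2 x ∈ perfectClosure L1 L2) : x ∈ perfectClosure K1 K2 := by
  have : ExpChar L1 (ringExpChar K1) :=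
    expChar_of_injective_algebraMap (algebraMap K1 L1).injective _
  obtain ⟨n, y, hy⟩ := (mem_perfectClosure_iff_pow_mem (ringExpChar K1)).1 hx
  rw [← map_pow] at hy
  have hyalg : IsAlgebraic K1 y := by
    rw [← isAlgebraic_algebraMap_iff (algebraMap L1 L2).injective, hy]
    exact (Algebra.IsAlgebraic.isAlgebraic _).algebraMap
  obtain ⟨z, rfl⟩ := hrac y hyalg
  refine mem_perfectClosure_iff.2 ⟨n, z, (algebraMap K2 L2).injective ?_⟩
  rw [← hy, ← IsScalarTower.algebraMap_apply, ← IsScalarTower.algebraMap_apply]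

theorem stmt7 {K1 K2 L1 L2 : Type u} [Field K1] [Field K2] [Field L1] [Field L2]
    [Algebra K1 K2] [Algebra K2 L2] [Algebra K1 L1] [Algebra L1 L2] [Algebra K1 L2]
    [IsScalarTower K1 K2 L2] [IsScalarTower K1 L1 L2]
    [Normal K1 K2] [FiniteDimensional K1 K2] [Normal L1 L2] [FiniteDimensional L1 L2]
    (hrac : RelAlgClosed (algebraMap K1 L1)) :
    (∀ τ : L2 ≃ₐ[L1] L2, ∀ x : K2, ∃ y : K2,
        τ (algebraMap K2 L2 x) = algebraMap K2 L2 y) ∧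
    (∀ σ : K2 ≃ₐ[K1] K2, ∃ τ : L2 ≃ₐ[L1] L2, ∀ x : K2,
        τ (algebraMap K2 L2 x) = algebraMap K2 L2 (σ x)) := by
  let res : (L2 ≃ₐ[L1] L2) →* (K2 ≃ₐ[K1] K2) :=
    (AlgEquiv.restrictNormalHom K2).comp (AlgEquiv.restrictScalarsHom K1)
  have hres (τ : L2 ≃ₐ[L1] L2) (x : K2) : algebraMap K2 L2 (res τ x) = τ (algebraMap K2 L2 x) :=
    (τ.restrictScalars K1).restrictNormal_commutes K2 x
  refine ⟨fun τ x ↦ ⟨res τ x, (hres τ x).symm⟩, fun σ ↦ ?_⟩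
  have hσ : σ ∈ res.range := by
    rw [← IntermediateField.fixingSubgroup_fixedField res.range,
      IntermediateField.mem_fixingSubgroup_iff]
    intro x hx
    rw [IntermediateField.mem_fixedField_iff] at hx
    refine algEquiv_apply_eq_of_mem_perfectClosure (hrac.mem_perfectClosure (L2 := L2) ?_) σ
    refine mem_perfectClosure_of_forall_algEquiv_eq fun τ ↦ ?_
    rw [← hres, hx _ ⟨τ, rfl⟩]
  obtain ⟨τ, rfl⟩ := hσ
  exact ⟨τ, fun x ↦ (hres τ x).symm⟩
end

section
/- Let K1 ⊆ K2 ⊆ L2 and K1 ⊆ L1 ⊆ L2 be towers of fields such that K2/K1 and L2/L1 are finite normal extensions and K1 is relatively algebraically closed in L1. Let O_{L1}, O_{K1}, O_{K2} be valuation subrings of L1, K1, K2 respectively, with O_{L1} ∩ K1 = O_{K2} ∩ K1 = O_{K1}. Then the set S of valuation subrings of L2 extending both O_{L1} and O_{K2} is finite and nonempty, the set A of valuation subrings of L2 extending O_{L1} and the set B of valuation subrings of K2 extending O_{K1} are finite and nonempty, and |S| · |B| = |A|. -/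
universe u

open Polynomial

/-- An element of a normal extension fixed by all automorphisms is purely inseparable over
the base field. -/
theorem Normal.exists_pow_mem_range_of_fixed {K L : Type*} [Field K] [Field L] [Algebra K L]
    [Normal K L] (q : ℕ) [ExpChar K q] {x : L} (hx : ∀ g : L ≃ₐ[K] L, g x = x) :
    ∃ n : ℕ, x ^ q ^ n ∈ (algebraMap K L).range := by
  classical
  have hint : IsIntegral K x := Normal.isIntegral inferInstance x
  rw [← minpoly.natSepDegree_eq_one_iff_pow_mem q,
    natSepDegree_eq_of_splits (minpoly K x) (Normal.splits inferInstance x),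
    Finset.card_eq_one]
  refine ⟨x, Finset.ext fun y => ?_⟩
  rw [Multiset.mem_toFinset, mem_aroots, Finset.mem_singleton]
  constructor
  · rintro ⟨-, hy⟩
    obtain ⟨g, hg⟩ := minpoly.exists_algEquiv_of_root (Algebra.IsAlgebraic.isAlgebraic x) hy
    exact g.injective (hg.trans (hx g).symm)
  · rintro rfl
    exact ⟨minpoly.ne_zero hint, minpoly.aeval K y⟩

/-- Restriction of automorphisms is surjective when the base of the smaller extension is
relatively algebraically closed in the base of the larger one. -/
theorem RelAlgClosed.exists_algEquiv_extending {K1 K2 L1 L2 : Type*}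
    [Field K1] [Field K2] [Field L1] [Field L2]
    [Algebra K1 K2] [Algebra K2 L2] [Algebra K1 L1] [Algebra L1 L2] [Algebra K1 L2]
    [IsScalarTower K1 K2 L2] [IsScalarTower K1 L1 L2]
    [Normal K1 K2] [FiniteDimensional K1 K2] [Normal L1 L2]
    (hrac : RelAlgClosed (algebraMap K1 L1)) (t : K2 ≃ₐ[K1] K2) :
    ∃ g : L2 ≃ₐ[L1] L2, ∀ x, g (algebraMap K2 L2 x) = algebraMap K2 L2 (t x) := by
  let r : (L2 ≃ₐ[L1] L2) →* (K2 ≃ₐ[K1] K2) :=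
    (AlgEquiv.restrictNormalHom K2).comp
      (MonoidHom.mk' (fun g : L2 ≃ₐ[L1] L2 => g.restrictScalars K1) fun _ _ => rfl)
  have hr : ∀ g x, algebraMap K2 L2 (r g x) = g (algebraMap K2 L2 x) := fun g x =>
    AlgEquiv.restrictNormal_commutes (g.restrictScalars K1) K2 x
  obtain ⟨q, _⟩ := ExpChar.exists K1
  have : ExpChar L1 q := expChar_of_injective_algebraMap (algebraMap K1 L1).injective q
  have : ExpChar K2 q := expChar_of_injective_algebraMap (algebraMap K1 K2).injective q
  have ht : t ∈ r.range := by
    rw [← IntermediateField.fixingSubgroup_fixedField r.range,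
      IntermediateField.mem_fixingSubgroup_iff]
    intro x hx
    rw [IntermediateField.mem_fixedField_iff] at hx
    have hfix : ∀ g : L2 ≃ₐ[L1] L2, g (algebraMap K2 L2 x) = algebraMap K2 L2 x := fun g => by
      rw [← hr, hx _ ⟨g, rfl⟩]
    obtain ⟨n, y, hy⟩ := Normal.exists_pow_mem_range_of_fixed q hfix
    have hint : IsIntegral K1 (x ^ q ^ n) := Normal.isIntegral inferInstance _
    obtain ⟨z, rfl⟩ : y ∈ Set.range (algebraMap K1 L1) := by
      refine hrac y ⟨minpoly K1 (x ^ q ^ n), minpoly.ne_zero hint, ?_⟩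
      apply (algebraMap L1 L2).injective
      rw [← aeval_def, ← aeval_algebraMap_apply, hy, ← map_pow, aeval_algebraMap_apply,
        minpoly.aeval, map_zero, map_zero]
    have hz : algebraMap K1 K2 z = x ^ q ^ n := by
      apply (algebraMap K2 L2).injective
      rw [map_pow, ← hy, ← IsScalarTower.algebraMap_apply, ← IsScalarTower.algebraMap_apply]
    apply iterateFrobenius_inj K2 q n
    rw [iterateFrobenius_def, iterateFrobenius_def, ← map_pow, ← hz, AlgEquiv.commutes]
  obtain ⟨g, rfl⟩ := ht
  exact ⟨g, fun x => (hr g x).symm⟩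

namespace ValuationSubring

/-- Every valuation subring extends along a field extension. -/
theorem exists_comap_algebraMap_eq {K : Type*} (L : Type*) [Field K] [Field L] [Algebra K L]
    (O : ValuationSubring K) : ∃ V : ValuationSubring L, V.comap (algebraMap K L) = O := by
  obtain ⟨V, h, hloc⟩ :=
    IsLocalRing.exists_factor_valuationRing ((algebraMap K L).comp O.subtype)
  refine ⟨V, ext _ _ fun x => ⟨fun hx => ?_, fun hx => h ⟨x, hx⟩⟩⟩
  by_contra hxO
  have hx0 : x ≠ 0 := by rintro rfl; exact hxO O.zero_mem
  have hinv : x⁻¹ ∈ O := (O.mem_or_inv_mem x).resolve_left hxO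
  have hu : IsUnit (⟨x⁻¹, hinv⟩ : O) := by
    apply hloc.map_nonunit
    refine .of_mul_eq_one ⟨algebraMap K L x, hx⟩ (Subtype.ext ?_)
    change algebraMap K L x⁻¹ * algebraMap K L x = 1
    rw [← map_mul, inv_mul_cancel₀ hx0, map_one]
  obtain ⟨u, hu⟩ := hu.exists_right_inv
  have hu' : x⁻¹ * (u : K) = 1 := congrArg Subtype.val hu
  have : (u : K) = x := by field_simp at hu'; exact hu'
  exact hxO (this ▸ u.2)

/-- Every nonzero polynomial has a multiple by a constant with coefficients in a given
valuation subring and some coefficient equal to `1`. -/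
theorem exists_C_mul_coeff_mem {K : Type*} [Field K] (O : ValuationSubring K) {f : K[X]}
    (hf : f ≠ 0) : ∃ c : K, (∀ n, (C c * f).coeff n ∈ O) ∧ ∃ n, (C c * f).coeff n = 1 := by
  obtain ⟨i, hi, hmax⟩ := f.support.exists_max_image (fun n => O.valuation (f.coeff n))
    (support_nonempty.2 hf)
  have hi0 : f.coeff i ≠ 0 := mem_support_iff.1 hi
  refine ⟨(f.coeff i)⁻¹, fun n => ?_, i, by rw [coeff_C_mul, inv_mul_cancel₀ hi0]⟩
  rw [coeff_C_mul, ← valuation_le_one_iff, map_mul, map_inv₀]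
  by_cases hn : n ∈ f.support
  · exact inv_mul_le_one_of_le₀ (hmax n hn) zero_le
  · rw [notMem_support_iff.1 hn]
    simp

/-- If `x` is algebraic over `K` and lies in a valuation subring `W`, then `x` is a fraction whose
numerator and denominator lie in all valuation subrings above `O`, with denominator a unit
of `W`. -/
theorem exists_denominator {K L : Type*} [Field K] [Field L] [Algebra K L]
    (O : ValuationSubring K) {W : ValuationSubring L}
    {x : L} (hx : IsAlgebraic K x) (hxW : x ∈ W) :
    ∃ y ∉ W.nonunits, ∀ V : ValuationSubring L, V.comap (algebraMap K L) = O →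
      y ∈ V ∧ y * x ∈ V := by
  obtain ⟨f₀, hf₀, hf₀x⟩ := hx
  obtain ⟨c, hcoeff, i, hi⟩ := O.exists_C_mul_coeff_mem hf₀
  set f := C c * f₀ with hf
  have hfx : aeval x f = 0 := by rw [hf, map_mul, hf₀x, mul_zero]
  let a : ℕ → L := fun n => aeval x (divX^[n] f)
  have ha0 : a 0 = 0 := hfx
  have hcoeff' : ∀ n m, (divX^[n] f).coeff m = f.coeff (m + n) := by
    intro n
    induction n with
    | zero => intro m; rfl
    | succ n ih =>
      intro m
      rw [Function.iterate_succ_apply', coeff_divX, ih]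
      congr 1
      ring
  have hrec : ∀ n, a n = a (n + 1) * x + algebraMap K L (f.coeff n) := by
    intro n
    have h := congrArg (aeval x) (divX_mul_X_add (divX^[n] f))
    rw [map_add, map_mul, aeval_X, aeval_C, hcoeff', zero_add] at h
    simp only [a, Function.iterate_succ_apply']
    exact h.symm
  have hmem : ∀ n, ∀ V : ValuationSubring L, V.comap (algebraMap K L) = O →
      a n ∈ V ∧ a n * x ∈ V := by
    intro n V hV
    have hc : ∀ n, algebraMap K L (f.coeff n) ∈ V := fun n => by
      rw [← mem_comap, hV]; exact hcoeff n
    by_cases hxV : x ∈ V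
    · have : a n ∈ V := by
        simp only [a, aeval_eq_sum_range, hcoeff', Algebra.smul_def]
        exact sum_mem fun m _ => MulMemClass.mul_mem (hc _) (pow_mem hxV m)
      exact ⟨this, MulMemClass.mul_mem this hxV⟩
    · have hx0 : x ≠ 0 := by rintro rfl; exact hxV V.zero_mem
      have hxi : x⁻¹ ∈ V := (V.mem_or_inv_mem x).resolve_left hxV
      have hmul : ∀ n, a (n + 1) * x = a n - algebraMap K L (f.coeff n) := fun n => by
        rw [hrec n, add_sub_cancel_right]
      have hall : ∀ n, a n ∈ V := by
        intro n
        induction n with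
        | zero => rw [ha0]; exact V.zero_mem
        | succ n ih =>
          rw [← mul_inv_cancel_right₀ hx0 (a (n + 1)), hmul]
          exact MulMemClass.mul_mem (sub_mem ih (hc n)) hxi
      refine ⟨hall n, ?_⟩
      cases n with
      | zero => rw [ha0, zero_mul]; exact V.zero_mem
      | succ n => rw [hmul]; exact sub_mem (hall n) (hc n)
  by_cases h : a i ∈ W.nonunits
  · refine ⟨a (i + 1), fun h' => ?_, hmem (i + 1)⟩
    have h1 : (1 : L) = a i - a (i + 1) * x := by
      rw [hrec i, hi, map_one, add_sub_cancel_left]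
    have hlt : W.valuation (a i - a (i + 1) * x) < 1 := by
      refine lt_of_le_of_lt (Valuation.map_sub _ _ _) (max_lt h ?_)
      rw [map_mul]
      exact mul_lt_one_of_lt_of_le h' ((W.valuation_le_one_iff x).2 hxW)
    rw [← h1, map_one] at hlt
    exact hlt.false
  · exact ⟨a i, h, hmem i⟩

theorem comap_algEquiv_comap_algebraMap {K L : Type*} [Field K] [Field L] [Algebra K L]
    (V : ValuationSubring L) (g : L ≃ₐ[K] L) :
    (V.comap (g : L →+* L)).comap (algebraMap K L) = V.comap (algebraMap K L) :=
  ext _ _ fun x => by simp [mem_comap]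

theorem mem_nonunits_comap {K L : Type*} [Field K] [Field L] {V : ValuationSubring L}
    {f : K →+* L} {x : K} : x ∈ (V.comap f).nonunits ↔ f x ∈ V.nonunits := by
  simp [mem_nonunits_iff_or, mem_comap]

/-- Up to an automorphism, one of two valuation subrings of a finite normal extension with the
same restriction to the base field is contained in the other. -/
theorem exists_comap_algEquiv_le {K L : Type*} [Field K] [Field L] [Algebra K L]
    [Normal K L] [FiniteDimensional K L] {V W : ValuationSubring L}
    (h : V.comap (algebraMap K L) = W.comap (algebraMap K L)) :
    ∃ g : L ≃ₐ[K] L, V.comap (g : L →+* L) ≤ W := by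
  classical
  set O := W.comap (algebraMap K L) with hO
  let R : Subring L :=
    ⨅ U : {U : ValuationSubring L // U.comap (algebraMap K L) = O}, U.1.toSubring
  have hR : ∀ {x : L}, x ∈ R ↔
      ∀ U : ValuationSubring L, U.comap (algebraMap K L) = O → x ∈ U := fun {x} => by
    simp only [R, Subring.mem_iInf, Subtype.forall]
    rfl
  have hG : ∀ (g : L ≃ₐ[K] L), (V.comap (g : L →+* L)).comap (algebraMap K L) = O := fun g => by
    rw [comap_algEquiv_comap_algebraMap, h]
  let P (U : ValuationSubring L) (hU : U.comap (algebraMap K L) = O) : Ideal R :=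
    (IsLocalRing.maximalIdeal U).comap
      (Subring.inclusion (show R ≤ U.toSubring from fun _ hx => hR.1 hx U hU) : R →+* U)
  have hP : ∀ U hU (x : R), x ∈ P U hU ↔ (x : L) ∈ U.nonunits := fun U hU x =>
    (coe_mem_nonunits_iff (A := U)).symm
  have hprime : ∀ U hU, (P U hU).IsPrime := fun U hU => Ideal.IsPrime.comap _
  obtain ⟨g, -, hg⟩ := (Ideal.subset_union_prime (s := Finset.univ)
    (f := fun g : L ≃ₐ[K] L => P (V.comap (g : L →+* L)) (hG g)) 1 1
    (fun g _ _ _ => hprime _ (hG g)) (I := P W rfl)).1 (by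
      intro x hx
      have hxW := (hP W rfl x).1 hx
      obtain ⟨q, _⟩ := ExpChar.exists K
      obtain ⟨n, z, hz⟩ := Normal.exists_pow_mem_range_of_fixed q
        (x := ∏ g : L ≃ₐ[K] L, g (x : L)) (fun s => by
          rw [map_prod]
          exact Fintype.prod_equiv (Equiv.mulLeft s) _ _ fun _ => rfl)
      have hqn : q ^ n ≠ 0 := pow_ne_zero _ (expChar_pos K q).ne'
      have hprodW : W.valuation (∏ g : L ≃ₐ[K] L, g (x : L)) < 1 := by
        rw [← Finset.mul_prod_erase _ _ (Finset.mem_univ (1 : L ≃ₐ[K] L)), map_mul]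
        refine mul_lt_one_of_lt_of_le hxW ((W.valuation_le_one_iff _).2 ?_)
        refine prod_mem fun g _ => ?_
        exact hR.1 x.2 (W.comap (g : L →+* L)) (comap_algEquiv_comap_algebraMap W g)
      have hzW : algebraMap K L z ∈ W.nonunits := by
        rw [hz, mem_nonunits_iff, map_pow]
        exact pow_lt_one₀ zero_le hprodW hqn
      have hzV : algebraMap K L z ∈ V.nonunits := by
        rwa [← mem_nonunits_comap, h, hO, mem_nonunits_comap]
      rw [hz, mem_nonunits_iff, map_pow, pow_lt_one_iff hqn, map_prod] at hzV
      obtain ⟨g, hg⟩ : ∃ g : L ≃ₐ[K] L, V.valuation (g (x : L)) < 1 := by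
        by_contra! hcon
        exact hzV.not_ge (Finset.one_le_prod' fun g _ => hcon g)
      refine Set.mem_iUnion₂.2 ⟨g, Finset.mem_coe.2 (Finset.mem_univ g), ?_⟩
      exact (hP _ (hG g) x).2 (mem_nonunits_comap.2 hg))
  refine ⟨g, fun x hx => ?_⟩
  obtain ⟨y, hy, hyR⟩ := O.exists_denominator (Algebra.IsAlgebraic.isAlgebraic x) hx
  have hyW : y ∉ W.nonunits := fun hyW =>
    hy ((hP _ (hG g) ⟨y, hR.2 fun U hU => (hyR U hU).1⟩).1 (hg ((hP W rfl _).2 hyW)))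
  rw [mem_nonunits_iff_or, not_or, not_not] at hyW
  rw [← inv_mul_cancel_left₀ hyW.1 x]
  exact MulMemClass.mul_mem hyW.2 (hyR W rfl).2

/-- The automorphism group of a finite normal extension acts transitively on the valuation
subrings above a given one. -/
theorem exists_comap_algEquiv_eq {K L : Type*} [Field K] [Field L] [Algebra K L]
    [Normal K L] [FiniteDimensional K L] {V W : ValuationSubring L}
    (h : V.comap (algebraMap K L) = W.comap (algebraMap K L)) :
    ∃ g : L ≃ₐ[K] L, V.comap (g : L →+* L) = W := by
  obtain ⟨g, hg⟩ := exists_comap_algEquiv_le h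
  obtain ⟨s, hs⟩ := exists_comap_algEquiv_le h.symm
  refine ⟨g, le_antisymm hg ?_⟩
  have hsg : ∀ x, s (g x) ∈ W → x ∈ W := fun x hx => hg (hs hx)
  have hpow : ∀ (n : ℕ) x, ((s * g) ^ n) x ∈ W → x ∈ W := by
    intro n
    induction n with
    | zero => intro x hx; exact hx
    | succ n ih => intro x hx; rw [pow_succ] at hx; exact hsg x (ih _ hx)
  obtain ⟨n, hn, hone⟩ := isOfFinOrder_iff_pow_eq_one.1 (isOfFinOrder_of_finite (s * g))
  intro x hx
  apply hs
  refine hpow (n - 1) _ ?_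
  change ((s * g) ^ (n - 1) * (s * g)) x ∈ W
  rwa [← pow_succ, Nat.sub_add_cancel hn, hone]

theorem finite_setOf_comap_algebraMap_eq {K : Type*} (L : Type*) [Field K] [Field L]
    [Algebra K L] [Normal K L] [FiniteDimensional K L] (O : ValuationSubring K) :
    {V : ValuationSubring L | V.comap (algebraMap K L) = O}.Finite := by
  obtain ⟨V, rfl⟩ := exists_comap_algebraMap_eq L O
  refine (Set.finite_range fun g : L ≃ₐ[K] L => V.comap (g : L →+* L)).subset fun W hW => ?_
  obtain ⟨g, hg⟩ := exists_comap_algEquiv_eq hW.symm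
  exact ⟨g, hg⟩

end ValuationSubring

theorem stmt8 {K1 K2 L1 L2 : Type u} [Field K1] [Field K2] [Field L1] [Field L2]
    [Algebra K1 K2] [Algebra K2 L2] [Algebra K1 L1] [Algebra L1 L2] [Algebra K1 L2]
    [IsScalarTower K1 K2 L2] [IsScalarTower K1 L1 L2]
    [Normal K1 K2] [FiniteDimensional K1 K2] [Normal L1 L2] [FiniteDimensional L1 L2]
    (hrac : RelAlgClosed (algebraMap K1 L1))
    (OL1 : ValuationSubring L1) (OK1 : ValuationSubring K1) (OK2 : ValuationSubring K2)
    (hL1 : OL1.comap (algebraMap K1 L1) = OK1) (hK2 : OK2.comap (algebraMap K1 K2) = OK1) :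
    let S := {O : ValuationSubring L2 |
      O.comap (algebraMap L1 L2) = OL1 ∧ O.comap (algebraMap K2 L2) = OK2}
    let A := {O : ValuationSubring L2 | O.comap (algebraMap L1 L2) = OL1}
    let B := {O : ValuationSubring K2 | O.comap (algebraMap K1 K2) = OK1}
    S.Finite ∧ S.Nonempty ∧ A.Finite ∧ A.Nonempty ∧ B.Finite ∧ B.Nonempty ∧
      S.ncard * B.ncard = A.ncard := by
  intro S A B
  have hSA : S ⊆ A := fun O hO => hO.1
  have hAfin : A.Finite := ValuationSubring.finite_setOf_comap_algebraMap_eq L2 OL1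
  have hBfin : B.Finite := ValuationSubring.finite_setOf_comap_algebraMap_eq K2 OK1
  have hAne : A.Nonempty := ValuationSubring.exists_comap_algebraMap_eq L2 OL1
  have hAB : ∀ O ∈ A, O.comap (algebraMap K2 L2) ∈ B := fun O hO => by
    change (O.comap (algebraMap K2 L2)).comap (algebraMap K1 K2) = OK1
    rw [← hL1, ← show O.comap (algebraMap L1 L2) = OL1 from hO, ValuationSubring.comap_comap,
      ValuationSubring.comap_comap, ← IsScalarTower.algebraMap_eq, ← IsScalarTower.algebraMap_eq]
  have hlift : ∀ Q : B, ∃ g : L2 ≃ₐ[L1] L2, ∀ O : ValuationSubring L2,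
      (O.comap (g : L2 →+* L2)).comap (algebraMap K2 L2) = Q.1 ↔
        O.comap (algebraMap K2 L2) = OK2 := by
    rintro ⟨Q, hQ⟩
    obtain ⟨t, rfl⟩ := ValuationSubring.exists_comap_algEquiv_eq (hK2.trans hQ.symm)
    obtain ⟨g, hg⟩ := hrac.exists_algEquiv_extending (L2 := L2) t
    refine ⟨g, fun O => ?_⟩
    have hcomm : (O.comap (g : L2 →+* L2)).comap (algebraMap K2 L2) =
        (O.comap (algebraMap K2 L2)).comap (t : K2 →+* K2) :=
      ValuationSubring.ext _ _ fun x => by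
        simp only [ValuationSubring.mem_comap, RingHom.coe_coe, hg]
    rw [hcomm]
    refine ⟨fun h => ValuationSubring.ext _ _ fun x => ?_, fun h => by rw [h]⟩
    have := SetLike.ext_iff.1 h (t.symm x)
    simpa [ValuationSubring.mem_comap] using this
  choose g hg using hlift
  have hcancel : ∀ (O : ValuationSubring L2) (s : L2 ≃ₐ[L1] L2),
      (O.comap (s : L2 →+* L2)).comap (s.symm : L2 →+* L2) = O := fun O s =>
    ValuationSubring.ext _ _ fun x => by simp [ValuationSubring.mem_comap]
  have hcancel' : ∀ (O : ValuationSubring L2) (s : L2 ≃ₐ[L1] L2),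
      (O.comap (s.symm : L2 →+* L2)).comap (s : L2 →+* L2) = O := fun O s =>
    ValuationSubring.ext _ _ fun x => by simp [ValuationSubring.mem_comap]
  have hA : ∀ (O : ValuationSubring L2) (s : L2 ≃ₐ[L1] L2), O ∈ A →
      O.comap (s : L2 →+* L2) ∈ A := fun O s hO =>
    (O.comap_algEquiv_comap_algebraMap s).trans hO
  have hS : ∀ (O : ValuationSubring L2) (hO : O ∈ A),
      O.comap ((g ⟨_, hAB O hO⟩).symm : L2 →+* L2) ∈ S := fun O hO =>
    ⟨hA _ _ hO, (hg ⟨_, hAB O hO⟩ _).1 (by rw [hcancel'])⟩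
  let e : S × B ≃ A :=
    { toFun := fun p => ⟨p.1.1.comap (g p.2 : L2 →+* L2), hA _ _ p.1.2.1⟩
      invFun := fun O => (⟨_, hS O.1 O.2⟩, ⟨_, hAB O.1 O.2⟩)
      left_inv := by
        rintro ⟨⟨O, hO⟩, Q⟩
        have hQ : (⟨_, hAB _ (hA O (g Q) hO.1)⟩ : B) = Q := Subtype.ext ((hg Q O).2 hO.2)
        refine Prod.ext (Subtype.ext ?_) hQ
        dsimp only
        rw [hQ, hcancel]
      right_inv := fun O => Subtype.ext (hcancel' _ _) }
  obtain ⟨O, hO⟩ := hAne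
  refine ⟨hAfin.subset hSA, ⟨_, hS O hO⟩, hAfin, ⟨O, hO⟩, hBfin, ⟨OK2, hK2⟩, ?_⟩
  rw [← Nat.card_coe_set_eq, ← Nat.card_coe_set_eq, ← Nat.card_coe_set_eq, ← Nat.card_prod,
    Nat.card_congr e]
end

section
/- Let P be a finite tree, let K0 be an algebraically closed field equipped with a T_P^0-structure, and let K1 and K2 be fields with T_P^0-structures extending that of K0 (via field extensions K0 ⊆ K1 and K0 ⊆ K2). Then there exist a field K3, field embeddings K1 → K3 and K2 → K3 agreeing on K0 such that the induced ring homomorphism K1 ⊗_{K0} K2 → K3 is injective, and a T_P^0-structure on K3 extending (via these embeddings) the structures on both K1 and K2. -/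
open TensorProduct

universe u v

/-- A `T_P^0`-structure on a field `K`: a family of valuation subrings of `K` indexed by
the poset `P`, with `O ⊥ = K` and `O q ⊆ O p` whenever `p ≤ q`. -/
structure TP0 (P : Type*) [PartialOrder P] [OrderBot P] (K : Type*) [Field K] where
  O : P → ValuationSubring K
  bot_eq : O ⊥ = ⊤
  antitone : ∀ {p q : P}, p ≤ q → O q ≤ O p

/-- A `T_P^0`-structure `t` on `L` extends the `T_P^0`-structure `s` on `K` along the
field embedding `f : K →+* L` if each valuation subring of `K` is the restriction of the
corresponding one of `L`. -/
def TP0.Extends {P : Type*} [PartialOrder P] [OrderBot P] {K L : Type*} [Field K] [Field L]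
    (f : K →+* L) (s : TP0 P K) (t : TP0 P L) : Prop :=
  ∀ p : P, (t.O p).comap f = s.O p

/-- Restriction of a `T_P^0`-structure along a field embedding. -/
def TP0.comap {P : Type*} [PartialOrder P] [OrderBot P] {K L : Type*} [Field K] [Field L]
    (f : K →+* L) (t : TP0 P L) : TP0 P K where
  O p := (t.O p).comap f
  bot_eq := by
    show (t.O ⊥).comap f = ⊤
    rw [t.bot_eq]
    ext x
    exact iff_of_true (ValuationSubring.mem_comap.mpr (ValuationSubring.mem_top _))
      (ValuationSubring.mem_top _)
  antitone := by
    intro p q hpq x hx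
    exact ValuationSubring.mem_comap.mpr (t.antitone hpq (ValuationSubring.mem_comap.mp hx))

theorem exists_algHom_of_finiteType (k A : Type*) [Field k] [IsAlgClosed k] [CommRing A]
    [Nontrivial A] [Algebra k A] [Algebra.FiniteType k A] : Nonempty (A →ₐ[k] k) := by
  obtain ⟨M, hM⟩ := Ideal.exists_maximal A
  let : Field (A ⧸ M) := Ideal.Quotient.field M
  have : Algebra.FiniteType k (A ⧸ M) := inferInstance
  have : Module.Finite k (A ⧸ M) := finite_of_finite_type_of_isJacobsonRing k (A ⧸ M)
  have hb : Function.Bijective (algebraMap k (A ⧸ M)) :=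
    IsAlgClosed.algebraMap_bijective_of_isIntegral
  exact ⟨((AlgEquiv.ofBijective (Algebra.ofId k (A ⧸ M)) hb).symm : (A ⧸ M) →ₐ[k] k).comp
    (Ideal.Quotient.mkₐ k M)⟩

theorem isDomain_tensorProduct_of_isAlgClosed (k A B : Type*) [Field k] [IsAlgClosed k]
    [Field A] [Field B] [Algebra k A] [Algebra k B] : IsDomain (A ⊗[k] B) := by
  have : NoZeroDivisors (A ⊗[k] B) := by
    refine ⟨fun {x y} hxy ↦ ?_⟩
    by_contra! hne
    let b := Module.Free.chooseBasis k B
    let c := Algebra.TensorProduct.basis A b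
    obtain ⟨i, hi⟩ : ∃ i, c.repr x i ≠ 0 := by
      by_contra! h
      exact hne.1 (c.repr.map_eq_zero_iff.1 (Finsupp.ext h))
    obtain ⟨j, hj⟩ : ∃ j, c.repr y j ≠ 0 := by
      by_contra! h
      exact hne.2 (c.repr.map_eq_zero_iff.1 (Finsupp.ext h))
    let s : Set A := Set.range (c.repr x) ∪ Set.range (c.repr y) ∪
      {(c.repr x i)⁻¹, (c.repr y j)⁻¹}
    have hs : s.Finite := ((Finsupp.finite_range _).union (Finsupp.finite_range _)).union
      (Set.toFinite _)
    let A' := Algebra.adjoin k s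
    have : Algebra.FiniteType k A' :=
      (Subalgebra.fg_iff_finiteType _).1 (Subalgebra.fg_def.2 ⟨s, hs, rfl⟩)
    obtain ⟨φ⟩ := exists_algHom_of_finiteType k A'
    have hlift : ∀ z : A ⊗[k] B, (∀ l, c.repr z l ∈ A') → ∀ l, c.repr z l ≠ 0 →
        (c.repr z l)⁻¹ ∈ A' → ∃ z' : A' ⊗[k] B,
        Algebra.TensorProduct.map A'.val (AlgHom.id k B) z' = z ∧
        Algebra.TensorProduct.lift ((Algebra.ofId k B).comp φ) (AlgHom.id k B)
          (fun _ _ ↦ Commute.all _ _) z' ≠ 0 := by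
      intro z hz l hl hl'
      refine ⟨∑ m ∈ (c.repr z).support, (⟨c.repr z m, hz m⟩ : A') ⊗ₜ b m, ?_, ?_⟩
      · conv_rhs => rw [← c.linearCombination_repr z]
        rw [Finsupp.linearCombination_apply, Finsupp.sum, map_sum]
        refine Finset.sum_congr rfl fun m _ ↦ ?_
        simp [c, Algebra.TensorProduct.basis_apply, TensorProduct.smul_tmul']
      · intro h0
        simp only [map_sum, Algebra.TensorProduct.lift_tmul, AlgHom.comp_apply,
          AlgHom.id_apply, Algebra.ofId_apply, ← Algebra.smul_def] at h0
        have := linearIndependent_iff'.1 b.linearIndependent _ _ h0 l (by simpa using hl)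
        have h1 : φ (⟨c.repr z l, hz l⟩ * ⟨_, hl'⟩) = 1 := by
          rw [← map_one φ]
          exact congrArg φ (Subtype.ext (mul_inv_cancel₀ hl))
        rw [map_mul, this, zero_mul] at h1
        exact zero_ne_one h1
    obtain ⟨x', hx', hx0⟩ := hlift x
      (fun l ↦ Algebra.subset_adjoin (.inl (.inl ⟨l, rfl⟩))) i hi
      (Algebra.subset_adjoin (.inr (.inl rfl)))
    obtain ⟨y', hy', hy0⟩ := hlift y
      (fun l ↦ Algebra.subset_adjoin (.inl (.inr ⟨l, rfl⟩))) j hj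
      (Algebra.subset_adjoin (.inr (.inr rfl)))
    have hinj : Function.Injective (Algebra.TensorProduct.map A'.val (AlgHom.id k B)) :=
      Module.Flat.rTensor_preserves_injective_linearMap (M := B) A'.val.toLinearMap
        Subtype.val_injective
    have h0 : x' * y' = 0 := hinj (by rw [map_mul, hx', hy', hxy, map_zero])
    apply mul_ne_zero hx0 hy0
    rw [← map_mul, h0, map_zero]
  exact NoZeroDivisors.to_isDomain _

theorem ValuationSubring.isAlgClosed_residueField {K : Type*} [Field K] [IsAlgClosed K]
    (A : ValuationSubring K) : IsAlgClosed (IsLocalRing.ResidueField A) := by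
  refine IsAlgClosed.of_exists_root _ fun p hp hirr ↦ ?_
  obtain ⟨q, hq, hdeg, hmonic⟩ := Polynomial.lifts_and_natDegree_eq_and_monic
    (Polynomial.map_surjective _ IsLocalRing.residue_surjective p) hp
  have hdeg' : (q.map (algebraMap A K)).degree ≠ 0 := by
    rw [hmonic.degree_map, Polynomial.degree_eq_natDegree hmonic.ne_zero, hdeg]
    exact_mod_cast hirr.natDegree_pos.ne'
  obtain ⟨x, hx⟩ := IsAlgClosed.exists_root _ hdeg'
  obtain ⟨y, rfl⟩ := IsIntegrallyClosed.isIntegral_iff.1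
    (⟨q, hmonic, by rwa [Polynomial.IsRoot, Polynomial.eval_map] at hx⟩ : IsIntegral A x)
  refine ⟨IsLocalRing.residue A y, ?_⟩
  rw [← hq, Polynomial.eval_map, Polynomial.eval₂_hom]
  have : q.eval y = 0 := by
    apply FaithfulSMul.algebraMap_injective A K
    rwa [map_zero, ← Polynomial.eval₂_hom, ← Polynomial.eval_map]
  rw [this, map_zero]

theorem ValuationSubring.mul_mem_nonunits {K : Type*} [Field K] (A : ValuationSubring K) {x y : K}
    (hx : x ∈ A) (hy : y ∈ A.nonunits) : x * y ∈ A.nonunits := by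
  rw [A.mem_nonunits_iff] at hy ⊢
  rw [map_mul]
  exact mul_lt_one_of_nonneg_of_lt_one_right ((A.valuation_le_one_iff x).2 hx) zero_le hy

theorem ValuationSubring.map_mem_nonunits_iff {K L : Type*} [Field K] [Field L] (f : K →+* L)
    {A : ValuationSubring K} {B : ValuationSubring L} (h : B.comap f = A) {x : K} :
    f x ∈ B.nonunits ↔ x ∈ A.nonunits := by
  subst h
  rw [mem_nonunits_iff_or, mem_nonunits_iff_or, ← map_inv₀, map_eq_zero, mem_comap]

/-- The valuation subring `V` of `L` restricts to `A₁` and `A₂` along `f₁` and `f₂`, and the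
residue fields of `A₁` and `A₂` are linearly disjoint over that of `A₀` inside the residue field
of `V`. -/
structure IsDisjointExtension {K₀ K₁ K₂ L : Type*} [Field K₀] [Field K₁] [Field K₂] [Field L]
    [Algebra K₀ K₁] (A₀ : ValuationSubring K₀) (A₁ : ValuationSubring K₁)
    (A₂ : ValuationSubring K₂) (f₁ : K₁ →+* L) (f₂ : K₂ →+* L) (V : ValuationSubring L) :
    Prop where
  comap_left : V.comap f₁ = A₁
  comap_right : V.comap f₂ = A₂
  mem_nonunits : ∀ (n : ℕ) (a : Fin n → K₁) (b : Fin n → K₂), (∀ i, a i ∈ A₁) → (∀ i, b i ∈ A₂) →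
    (∀ c : Fin n → K₀, (∀ i, c i ∈ A₀) → ∑ i, algebraMap K₀ K₁ (c i) * a i ∈ A₁.nonunits →
      ∀ i, c i ∈ A₀.nonunits) →
    ∑ i, f₁ (a i) * f₂ (b i) ∈ V.nonunits → ∀ i, b i ∈ A₂.nonunits

section

variable {K₀ K₁ K₂ L : Type*} [Field K₀] [Field K₁] [Field K₂] [Field L]
  [Algebra K₀ K₁] [Algebra K₀ K₂] {A₀ B₀ : ValuationSubring K₀} {A₁ B₁ : ValuationSubring K₁}
  {A₂ B₂ : ValuationSubring K₂} {f₁ : K₁ →+* L} {f₂ : K₂ →+* L} {V : ValuationSubring L}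

theorem IsDisjointExtension.sum_eq_zero (hV : IsDisjointExtension A₀ A₁ A₂ f₁ f₂ V)
    (hf : ∀ x, f₁ (algebraMap K₀ K₁ x) = f₂ (algebraMap K₀ K₂ x))
    (h₀ : B₀ ≤ A₀) (h₁ : B₁ ≤ A₁) (h₂ : B₂ ≤ A₂)
    (hA₁ : A₁.comap (algebraMap K₀ K₁) = A₀)
    (hB₁ : ∀ x : B₀, algebraMap K₀ K₁ x ∈ B₁) (hB₂ : ∀ x : B₀, algebraMap K₀ K₂ x ∈ B₂)
    {D : Type*} [CommRing D] (g₁ : B₁ →+* D) (g₂ : B₂ →+* D)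
    (hg : ∀ x : B₀, g₁ ⟨_, hB₁ x⟩ = g₂ ⟨_, hB₂ x⟩)
    (hg₁ : ∀ x : B₁, (x : K₁) ∈ B₁.nonunits → g₁ x = 0)
    (hg₂ : ∀ x : B₂, (x : K₂) ∈ B₂.nonunits → g₂ x = 0)
    {n : ℕ} (a : Fin n → B₁) (b : Fin n → B₂)
    (hab : ∑ i, f₁ (a i) * f₂ (b i) ∈ V.nonunits) : ∑ i, g₁ (a i) * g₂ (b i) = 0 := by
  induction n with
  | zero => simp
  | succ n ih =>
    by_cases hind : ∀ c : Fin (n + 1) → K₀, (∀ i, c i ∈ A₀) →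
        ∑ i, algebraMap K₀ K₁ (c i) * a i ∈ A₁.nonunits → ∀ i, c i ∈ A₀.nonunits
    · have := hV.mem_nonunits _ (fun i ↦ (a i : K₁)) (fun i ↦ (b i : K₂)) (fun i ↦ h₁ (a i).2)
        (fun i ↦ h₂ (b i).2) hind hab
      refine Finset.sum_eq_zero fun i _ ↦ ?_
      rw [hg₂ _ (ValuationSubring.nonunits_le_nonunits.2 h₂ (this i)), mul_zero]
    · push Not at hind
      obtain ⟨c, hc, hsum, j, hj⟩ := hind
      obtain ⟨k, hk⟩ := Finite.exists_max fun i ↦ B₀.valuation (c i)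
      have hck0 : c k ≠ 0 := by
        intro h
        have hj0 : c j = 0 := by simpa [h] using hk j
        exact hj (by rw [hj0]; exact A₀.nonunits.zero_mem)
      have hd : ∀ i, c i / c k ∈ B₀ := fun i ↦ by
        rw [← B₀.valuation_le_one_iff, map_div₀]
        exact div_le_one_of_le₀ (hk i) zero_le
      have hck : (c k)⁻¹ ∈ A₀ := by
        by_contra h
        refine hj ?_
        rw [← div_mul_cancel₀ (c j) hck0]
        exact A₀.mul_mem_nonunits (h₀ (hd j)) (A₀.mem_nonunits_iff_or.2 (.inr h))
      let d : Fin (n + 1) → B₀ := fun i ↦ ⟨c i / c k, hd i⟩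
      let d₁ : Fin (n + 1) → B₁ := fun i ↦ ⟨_, hB₁ (d i)⟩
      let d₂ : Fin (n + 1) → B₂ := fun i ↦ ⟨_, hB₂ (d i)⟩
      let m : B₁ := a k + ∑ i, d₁ (k.succAbove i) * a (k.succAbove i)
      have hm : (m : K₁) ∈ A₁.nonunits := by
        have hmul := A₁.mul_mem_nonunits (x := algebraMap K₀ K₁ (c k)⁻¹)
          (by rwa [← ValuationSubring.mem_comap, hA₁]) hsum
        convert hmul using 1
        rw [Fin.sum_univ_succAbove _ k, mul_add, Finset.mul_sum, ← mul_assoc, ← map_mul,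
          inv_mul_cancel₀ hck0, map_one, one_mul]
        simp only [m, d₁, d]
        push_cast
        congr 1
        refine Finset.sum_congr rfl fun i _ ↦ ?_
        rw [← mul_assoc, div_eq_inv_mul]
      let b' : Fin n → B₂ := fun i ↦ b (k.succAbove i) - d₂ (k.succAbove i) * b k
      have hdf : ∀ i, f₁ (d₁ i) = f₂ (d₂ i) := fun i ↦ hf _
      have hdg : ∀ i, g₁ (d₁ i) = g₂ (d₂ i) := fun i ↦ hg _
      have hfsum : ∑ i, f₁ (a i) * f₂ (b i) =
          ∑ i, f₁ (a (k.succAbove i)) * f₂ (b' i) + f₂ (b k) * f₁ m := by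
        rw [Fin.sum_univ_succAbove _ k]
        simp only [m, b']
        push_cast
        simp only [map_add, map_sub, map_mul, map_sum, mul_sub, Finset.sum_sub_distrib, mul_add,
          Finset.mul_sum, hdf]
        have : ∀ i, f₁ (a (k.succAbove i)) * (f₂ (d₂ (k.succAbove i)) * f₂ (b k)) =
          f₂ (b k) * (f₂ (d₂ (k.succAbove i)) * f₁ (a (k.succAbove i))) := fun i ↦ by ring
        simp only [this]
        ring
      have hgsum : ∑ i, g₁ (a i) * g₂ (b i) =
          ∑ i, g₁ (a (k.succAbove i)) * g₂ (b' i) + g₂ (b k) * g₁ m := by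
        rw [Fin.sum_univ_succAbove _ k]
        simp only [m, b', map_add, map_sub, map_mul, map_sum, mul_sub, Finset.sum_sub_distrib,
          mul_add, Finset.mul_sum, hdg]
        have : ∀ i, g₁ (a (k.succAbove i)) * (g₂ (d₂ (k.succAbove i)) * g₂ (b k)) =
          g₂ (b k) * (g₂ (d₂ (k.succAbove i)) * g₁ (a (k.succAbove i))) := fun i ↦ by ring
        simp only [this]
        ring
      have hrest : f₂ (b k) * f₁ m ∈ V.nonunits :=
        V.mul_mem_nonunits
          (by rw [← ValuationSubring.mem_comap, hV.comap_right]; exact h₂ (b k).2)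
          ((ValuationSubring.map_mem_nonunits_iff f₁ hV.comap_left).2 hm)
      rw [hgsum, hg₁ m (ValuationSubring.nonunits_le_nonunits.2 h₁ hm), mul_zero, add_zero]
      refine ih _ _ ?_
      have := V.nonunits.sub_mem hab hrest
      rwa [hfsum, add_sub_cancel_right] at this

end

/-- A homomorphism to a domain whose kernel contains the elements mapped to nonunits of `V` is
realised, up to its kernel, by a valuation subring refining `V`. -/
theorem ValuationSubring.exists_le_of_ringHom {L R D : Type*} [Field L] [CommRing R] [CommRing D]
    [IsDomain D] (V : ValuationSubring L) (g : R →+* L) (h : R →+* D)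
    (hgV : ∀ x, g x ∈ V) (hker : ∀ x, g x ∈ V.nonunits → h x = 0) :
    ∃ W : ValuationSubring L, W ≤ V ∧ (∀ x, g x ∈ W) ∧ ∀ x, g x ∈ W.nonunits ↔ h x = 0 := by
  let S : Subring L :=
    { carrier := {y | ∃ x, y - g x ∈ V.nonunits}
      mul_mem' := by
        rintro y z ⟨x, hx⟩ ⟨x', hx'⟩
        refine ⟨x * x', ?_⟩
        have hz : z ∈ V := by
          simpa using V.add_mem _ _ (ValuationSubring.nonunits_subset hx') (hgV x')
        have := V.nonunits.add_mem (V.mul_mem_nonunits hz hx) (V.mul_mem_nonunits (hgV x) hx')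
        convert this using 1
        rw [map_mul]; ring
      one_mem' := ⟨1, by simp [V.nonunits.zero_mem]⟩
      add_mem' := by
        rintro y z ⟨x, hx⟩ ⟨x', hx'⟩
        refine ⟨x + x', ?_⟩
        convert V.nonunits.add_mem hx hx' using 1
        rw [map_add]; ring
      zero_mem' := ⟨0, by simp [V.nonunits.zero_mem]⟩
      neg_mem' := by
        rintro y ⟨x, hx⟩
        refine ⟨-x, ?_⟩
        convert V.nonunits.neg_mem hx using 1
        rw [map_neg]; ring }
  have hmem : ∀ y : S, ∃ x, (y : L) - g x ∈ V.nonunits := fun y ↦ y.2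
  have hSV : ∀ y : S, (y : L) ∈ V := fun y ↦ by
    obtain ⟨x, hx⟩ := hmem y
    simpa using V.add_mem _ _ (ValuationSubring.nonunits_subset hx) (hgV x)
  have hunique : ∀ (y : S) (x x' : R), (y : L) - g x ∈ V.nonunits → (y : L) - g x' ∈ V.nonunits →
      h x = h x' := by
    intro y x x' hx hx'
    rw [← sub_eq_zero, ← map_sub]
    refine hker _ ?_
    convert V.nonunits.sub_mem hx' hx using 1
    rw [map_sub]; ring
  choose r hr using hmem
  have hr_eq : ∀ (y : S) (x : R), (y : L) - g x ∈ V.nonunits → h (r y) = h x :=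
    fun y x hx ↦ hunique y _ _ (hr y) hx
  let ψ : S →+* D :=
    { toFun := fun y ↦ h (r y)
      map_one' := by
        rw [hr_eq 1 1 (by simp [V.nonunits.zero_mem]), map_one]
      map_zero' := by
        rw [hr_eq 0 0 (by simp [V.nonunits.zero_mem]), map_zero]
      map_add' := fun y z ↦ by
        rw [← map_add]
        refine hr_eq _ _ ?_
        convert V.nonunits.add_mem (hr y) (hr z) using 1
        rw [map_add, Subring.coe_add]; ring
      map_mul' := fun y z ↦ by
        rw [← map_mul]
        refine hr_eq _ _ ?_
        convert V.nonunits.add_mem (V.mul_mem_nonunits (hSV z) (hr y))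
          (V.mul_mem_nonunits (hgV (r y)) (hr z)) using 1
        rw [map_mul, Subring.coe_mul]; ring }
  let J : Ideal S := RingHom.ker ψ
  have hJ : J.IsPrime := RingHom.ker_isPrime ψ
  obtain ⟨W, hW⟩ := (LocalSubring.ofPrime S J).exists_le_valuationSubring
  have hSW : ∀ y : S, (y : L) ∈ W := fun y ↦ hW.1 (LocalSubring.le_ofPrime S J y.2)
  have hSJ : ∀ y : S, (y : L) ∈ W.nonunits ↔ ψ y = 0 := by
    intro y
    let y' : (LocalSubring.ofPrime S J).toSubring := algebraMap S _ y
    have h1 : IsUnit y' ↔ y ∉ J :=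
      IsLocalization.AtPrime.isUnit_to_map_iff (LocalSubring.ofPrime S J).toSubring J y
    have h2 : IsUnit (Subring.inclusion hW.1 y') ↔ IsUnit y' :=
      ⟨fun hu ↦ hW.2.1 y' hu, fun hu ↦ hu.map _⟩
    have h3 : (y : L) ∈ W.nonunits ↔ ¬ IsUnit (⟨y, hSW y⟩ : W) :=
      W.coe_mem_nonunits_iff (a := ⟨y, hSW y⟩)
    have h4 : IsUnit (⟨y, hSW y⟩ : W) ↔ IsUnit (Subring.inclusion hW.1 y') := Iff.rfl
    rw [h3, h4, h2, h1, not_not, RingHom.mem_ker]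
  have hgS : ∀ x, g x ∈ S := fun x ↦ ⟨x, by simp [V.nonunits.zero_mem]⟩
  refine ⟨W, ValuationSubring.nonunits_le_nonunits.1 fun y hy ↦ ?_, fun x ↦ hSW ⟨g x, hgS x⟩,
    fun x ↦ ?_⟩
  · have hyS : y - g 0 ∈ V.nonunits := by simpa using hy
    rw [hSJ ⟨y, 0, hyS⟩]
    exact (hr_eq ⟨y, 0, hyS⟩ 0 hyS).trans (map_zero h)
  · rw [hSJ ⟨g x, hgS x⟩]
    show h (r ⟨g x, hgS x⟩) = 0 ↔ h x = 0
    rw [hr_eq ⟨g x, hgS x⟩ x (by simp [V.nonunits.zero_mem])]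

theorem TensorProduct.exists_fin_sum {R M N : Type*} [CommSemiring R] [AddCommMonoid M]
    [AddCommMonoid N] [Module R M] [Module R N] (x : M ⊗[R] N) :
    ∃ (n : ℕ) (a : Fin n → M) (b : Fin n → N), x = ∑ i, a i ⊗ₜ b i := by
  obtain ⟨s, rfl⟩ := TensorProduct.exists_finset x
  refine ⟨s.card, fun i ↦ (s.equivFin.symm i).1.1, fun i ↦ (s.equivFin.symm i).1.2, ?_⟩
  rw [s.equivFin.symm.sum_comp (fun i : s ↦ i.1.1 ⊗ₜ[R] i.1.2),
    Finset.sum_coe_sort s (fun i ↦ i.1 ⊗ₜ[R] i.2)]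

theorem TensorProduct.eq_zero_of_sum_tmul_eq_zero {k M N ι : Type*} [Field k] [AddCommGroup M]
    [AddCommGroup N] [Module k M] [Module k N] [Fintype ι] {a : ι → M} {b : ι → N}
    (ha : LinearIndependent k a) (h : ∑ i, a i ⊗ₜ[k] b i = 0) (i : ι) : b i = 0 := by
  classical
  let c := Module.Free.chooseBasis k N
  have hli := ha.tmul_of_isDomain c.linearIndependent
  refine c.repr.map_eq_zero_iff.1 (Finsupp.ext fun l ↦ ?_)
  have hsum : ∑ p ∈ Finset.univ ×ˢ Finset.univ.biUnion (fun i ↦ (c.repr (b i)).support),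
      c.repr (b p.1) p.2 • (a p.1 ⊗ₜ[k] c p.2) = 0 := by
    rw [Finset.sum_product, ← h]
    refine Finset.sum_congr rfl fun i _ ↦ ?_
    conv_rhs => rw [← c.linearCombination_repr (b i), Finsupp.linearCombination_apply,
      Finsupp.sum_of_support_subset _ (Finset.subset_biUnion_of_mem
        (fun i ↦ (c.repr (b i)).support) (Finset.mem_univ i)) _ (by simp)]
    simp [TensorProduct.tmul_sum]
  by_cases hl : l ∈ (c.repr (b i)).support
  · exact linearIndependent_iff'.1 hli _ _ hsum (i, l) (by
      simp only [Finset.mem_product, Finset.mem_univ, true_and, Finset.mem_biUnion]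
      exact ⟨i, hl⟩)
  · simpa using hl

theorem ValuationSubring.mem_nonunits_top {K : Type*} [Field K] {x : K} :
    x ∈ (⊤ : ValuationSubring K).nonunits ↔ x = 0 := by
  simp [ValuationSubring.mem_nonunits_iff_or, ValuationSubring.mem_top]

theorem isDisjointExtension_top {K₀ K₁ K₂ L : Type*} [Field K₀] [Field K₁] [Field K₂] [Field L]
    [Algebra K₀ K₁] {f₁ : K₁ →+* L} {f₂ : K₂ →+* L}
    (hind : ∀ (n : ℕ) (a : Fin n → K₁) (b : Fin n → K₂), LinearIndependent K₀ a →
      ∑ i, f₁ (a i) * f₂ (b i) = 0 → ∀ i, b i = 0) :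
    IsDisjointExtension (⊤ : ValuationSubring K₀) ⊤ ⊤ f₁ f₂ ⊤ := by
  refine ⟨?_, ?_, fun n a b _ _ hc hab i ↦ ?_⟩
  · ext; simp [ValuationSubring.mem_top]
  · ext; simp [ValuationSubring.mem_top]
  · simp only [ValuationSubring.mem_nonunits_top] at hc hab ⊢
    refine hind n a b (Fintype.linearIndependent_iff.2 fun c h ↦ ?_) hab i
    exact hc c (fun _ ↦ ValuationSubring.mem_top _) (by simpa only [Algebra.smul_def] using h)

section

variable {K₀ K₁ K₂ L : Type*} [Field K₀] [Field K₁] [Field K₂] [Field L]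
  [Algebra K₀ K₁] [Algebra K₀ K₂] {A₀ B₀ : ValuationSubring K₀} {A₁ B₁ : ValuationSubring K₁}
  {A₂ B₂ : ValuationSubring K₂} {f₁ : K₁ →+* L} {f₂ : K₂ →+* L} {V : ValuationSubring L}

theorem ValuationSubring.comap_eq_of_nonunits (f : K₁ →+* L) (h : ∀ x : B₁, f x ∈ V)
    (h' : ∀ x : B₁, (x : K₁) ∈ B₁.nonunits → f x ∈ V.nonunits) : V.comap f = B₁ := by
  ext x
  refine ⟨fun hx ↦ ?_, fun hx ↦ h ⟨x, hx⟩⟩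
  by_contra hx'
  have hx0 : x ≠ 0 := by rintro rfl; exact hx' B₁.zero_mem
  have hinv : x⁻¹ ∈ B₁.nonunits := B₁.inv_mem_nonunits_iff.2 (.inr hx')
  have := h' ⟨x⁻¹, ValuationSubring.nonunits_subset hinv⟩ hinv
  rw [map_inv₀, V.inv_mem_nonunits_iff, map_eq_zero] at this
  exact this.elim hx0 fun h ↦ h hx

theorem IsDisjointExtension.exists_le [IsAlgClosed K₀]
    (hV : IsDisjointExtension A₀ A₁ A₂ f₁ f₂ V)
    (hf : ∀ x, f₁ (algebraMap K₀ K₁ x) = f₂ (algebraMap K₀ K₂ x))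
    (h₁ : B₁ ≤ A₁) (h₂ : B₂ ≤ A₂) (hA₁ : A₁.comap (algebraMap K₀ K₁) = A₀)
    (hB₁ : B₁.comap (algebraMap K₀ K₁) = B₀) (hB₂ : B₂.comap (algebraMap K₀ K₂) = B₀) :
    ∃ W ≤ V, IsDisjointExtension B₀ B₁ B₂ f₁ f₂ W := by
  have h₀ : B₀ ≤ A₀ := by
    subst hA₁ hB₁
    exact fun x hx ↦ h₁ hx
  have hm₁ : ∀ x : B₀, algebraMap K₀ K₁ x ∈ B₁ := fun x ↦ by
    rw [← ValuationSubring.mem_comap, hB₁]; exact x.2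
  have hm₂ : ∀ x : B₀, algebraMap K₀ K₂ x ∈ B₂ := fun x ↦ by
    rw [← ValuationSubring.mem_comap, hB₂]; exact x.2
  let j₁ : B₀ →+* B₁ := ((algebraMap K₀ K₁).comp B₀.subtype).codRestrict B₁ hm₁
  let j₂ : B₀ →+* B₂ := ((algebraMap K₀ K₂).comp B₀.subtype).codRestrict B₂ hm₂
  have hj₁ : IsLocalHom j₁ := ⟨fun x hx ↦ by
    by_contra h
    exact B₁.coe_mem_nonunits_iff.1 ((ValuationSubring.map_mem_nonunits_iff _ hB₁).2
      (B₀.coe_mem_nonunits_iff.2 h)) hx⟩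
  have hj₂ : IsLocalHom j₂ := ⟨fun x hx ↦ by
    by_contra h
    exact B₂.coe_mem_nonunits_iff.1 ((ValuationSubring.map_mem_nonunits_iff _ hB₂).2
      (B₀.coe_mem_nonunits_iff.2 h)) hx⟩
  let κ₀ := IsLocalRing.ResidueField B₀
  let κ₁ := IsLocalRing.ResidueField B₁
  let κ₂ := IsLocalRing.ResidueField B₂
  let : Algebra κ₀ κ₁ := (IsLocalRing.ResidueField.map j₁).toAlgebra
  let : Algebra κ₀ κ₂ := (IsLocalRing.ResidueField.map j₂).toAlgebra
  have : IsAlgClosed κ₀ := B₀.isAlgClosed_residueField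
  have : IsDomain (κ₁ ⊗[κ₀] κ₂) := isDomain_tensorProduct_of_isAlgClosed κ₀ κ₁ κ₂
  let g₁ : B₁ →+* κ₁ ⊗[κ₀] κ₂ :=
    Algebra.TensorProduct.includeLeftRingHom.comp (IsLocalRing.residue B₁)
  let g₂ : B₂ →+* κ₁ ⊗[κ₀] κ₂ :=
    (Algebra.TensorProduct.includeRight : κ₂ →ₐ[κ₀] _).toRingHom.comp (IsLocalRing.residue B₂)
  have hg : ∀ x : B₀, g₁ ⟨_, hm₁ x⟩ = g₂ ⟨_, hm₂ x⟩ := fun x ↦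
    Algebra.TensorProduct.tmul_one_eq_one_tmul (A := κ₁) (B := κ₂) (IsLocalRing.residue B₀ x)
  have hg₁ : ∀ x : B₁, (x : K₁) ∈ B₁.nonunits → g₁ x = 0 := fun x hx ↦ by
    have : IsLocalRing.residue B₁ x = 0 :=
      (IsLocalRing.residue_eq_zero_iff x).2 (B₁.coe_mem_nonunits_iff.1 hx)
    rw [RingHom.comp_apply, this, map_zero]
  have hg₂ : ∀ x : B₂, (x : K₂) ∈ B₂.nonunits → g₂ x = 0 := fun x hx ↦ by
    have : IsLocalRing.residue B₂ x = 0 :=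
      (IsLocalRing.residue_eq_zero_iff x).2 (B₂.coe_mem_nonunits_iff.1 hx)
    rw [RingHom.comp_apply, this, map_zero]
  let g : B₁ ⊗[ℤ] B₂ →+* L := (Algebra.TensorProduct.productMap
    (f₁.comp B₁.subtype).toIntAlgHom (f₂.comp B₂.subtype).toIntAlgHom).toRingHom
  let h : B₁ ⊗[ℤ] B₂ →+* κ₁ ⊗[κ₀] κ₂ := (Algebra.TensorProduct.productMap
    g₁.toIntAlgHom g₂.toIntAlgHom).toRingHom
  have hg_tmul : ∀ a b, g (a ⊗ₜ b) = f₁ a * f₂ b := fun a b ↦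
    Algebra.TensorProduct.productMap_apply_tmul _ _ a b
  have hh_tmul : ∀ a b, h (a ⊗ₜ b) = g₁ a * g₂ b := fun a b ↦
    Algebra.TensorProduct.productMap_apply_tmul _ _ a b
  have hf₁V : ∀ x : B₁, f₁ x ∈ V := fun x ↦ by
    rw [← ValuationSubring.mem_comap, hV.comap_left]; exact h₁ x.2
  have hf₂V : ∀ x : B₂, f₂ x ∈ V := fun x ↦ by
    rw [← ValuationSubring.mem_comap, hV.comap_right]; exact h₂ x.2
  obtain ⟨W, hWV, hgW, hW⟩ := V.exists_le_of_ringHom g h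
    (fun x ↦ by
      obtain ⟨n, a, b, rfl⟩ := TensorProduct.exists_fin_sum x
      rw [map_sum]
      refine sum_mem fun i _ ↦ ?_
      rw [hg_tmul]
      exact mul_mem (hf₁V _) (hf₂V _))
    (fun x hx ↦ by
      obtain ⟨n, a, b, rfl⟩ := TensorProduct.exists_fin_sum x
      simp only [map_sum, hg_tmul, hh_tmul] at hx ⊢
      exact hV.sum_eq_zero hf h₀ h₁ h₂ hA₁ hm₁ hm₂ g₁ g₂ hg hg₁ hg₂ a b hx)
  refine ⟨W, hWV, ?_, ?_, ?_⟩
  · refine ValuationSubring.comap_eq_of_nonunits f₁ (fun x ↦ ?_) (fun x hx ↦ ?_)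
    · simpa [hg_tmul] using hgW (x ⊗ₜ 1)
    · simpa [hg_tmul] using (hW (x ⊗ₜ 1)).2 (by rw [hh_tmul, hg₁ x hx, zero_mul])
  · refine ValuationSubring.comap_eq_of_nonunits f₂ (fun x ↦ ?_) (fun x hx ↦ ?_)
    · simpa [hg_tmul] using hgW (1 ⊗ₜ x)
    · simpa [hg_tmul] using (hW (1 ⊗ₜ x)).2 (by rw [hh_tmul, hg₂ x hx, mul_zero])
  · intro n a b ha hb hind hab i
    lift a to Fin n → B₁ using ha
    lift b to Fin n → B₂ using hb
    have hli : LinearIndependent κ₀ fun i ↦ (IsLocalRing.residue B₁ (a i) : κ₁) := by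
      rw [Fintype.linearIndependent_iff]
      intro c hc
      choose d hd using fun i ↦ IsLocalRing.residue_surjective (c i)
      have hsum : (∑ i, j₁ (d i) * a i : B₁) ∈ IsLocalRing.maximalIdeal B₁ := by
        rw [← IsLocalRing.residue_eq_zero_iff, ← hc, map_sum]
        refine Finset.sum_congr rfl fun i _ ↦ ?_
        rw [map_mul, ← hd, Algebra.smul_def]
        rfl
      have := hind (fun i ↦ d i) (fun i ↦ (d i).2) (by
        rw [← B₁.coe_mem_nonunits_iff] at hsum
        convert hsum using 1
        push_cast
        rfl)
      intro i
      rw [← hd, IsLocalRing.residue_eq_zero_iff]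
      exact B₀.coe_mem_nonunits_iff.1 (this i)
    have h0 : h (∑ i, a i ⊗ₜ b i) = 0 := (hW _).1 (by simpa only [map_sum, hg_tmul] using hab)
    have h0' : ∑ i, (IsLocalRing.residue B₁ (a i) : κ₁) ⊗ₜ[κ₀]
        (IsLocalRing.residue B₂ (b i) : κ₂) = 0 := by
      rw [← h0, map_sum]
      refine Finset.sum_congr rfl fun i _ ↦ ?_
      rw [hh_tmul]
      simp [g₁, g₂]
    exact B₂.coe_mem_nonunits_iff.2 ((IsLocalRing.residue_eq_zero_iff _).1
      (TensorProduct.eq_zero_of_sum_tmul_eq_zero hli h0' i))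

end

/-- Recursion along a finite tree: a choice at the root that can be refined along every strict
inequality extends to an antitone choice on the whole tree. -/
theorem exists_antitone_of_isChain {P α : Type*} [PartialOrder P] [OrderBot P] [Finite P]
    [Preorder α] (htree : ∀ x : P, IsChain (· ≤ ·) {y : P | y ≤ x}) (Good : P → α → Prop)
    {a₀ : α} (h₀ : Good ⊥ a₀)
    (step : ∀ p q, p < q → ∀ a, Good p a → ∃ b ≤ a, Good q b) :
    ∃ O : P → α, O ⊥ = a₀ ∧ (∀ p, Good p (O p)) ∧ Antitone O := by
  have hpred : ∀ p : P, p ≠ ⊥ → ∃ q, q < p ∧ ∀ y < p, y ≤ q := by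
    intro p hp
    obtain ⟨q, hq⟩ := (Set.toFinite {y | y < p}).exists_maximal ⟨⊥, bot_lt_iff_ne_bot.2 hp⟩
    refine ⟨q, hq.prop, fun y hy ↦ ?_⟩
    exact ((htree p).total hy.le hq.prop.le).elim id fun h ↦ hq.le_of_ge hy h
  choose! pred hlt hle using hpred
  choose! next hnext_le hnext using step
  classical
  let G : ∀ p, {a // Good p a} := (wellFounded_lt (α := P)).fix fun p ih ↦
    if h : p = ⊥ then ⟨a₀, h ▸ h₀⟩
    else ⟨next (pred p) p (ih (pred p) (hlt p h)), hnext _ _ (hlt p h) _ (ih _ _).2⟩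
  have hbot : (G ⊥ : α) = a₀ := by
    simp only [G]
    rw [WellFounded.fix_eq, dif_pos rfl]
  have hG : ∀ p, p ≠ ⊥ → (G p : α) ≤ G (pred p) := by
    intro p hp
    have : (G p : α) = next (pred p) p (G (pred p)) := by
      simp only [G]
      conv_lhs => rw [WellFounded.fix_eq, dif_neg hp]
    rw [this]
    exact hnext_le _ _ (hlt p hp) _ (G _).2
  refine ⟨fun p ↦ G p, hbot, fun p ↦ (G p).2, fun p q ↦ ?_⟩
  induction q using WellFoundedLT.induction with
  | ind q ih =>
    intro hpq
    rcases hpq.eq_or_lt with rfl | hlt'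
    · exact le_rfl
    · have hq : q ≠ ⊥ := (bot_le.trans_lt hlt').ne'
      exact (hG q hq).trans (ih _ (hlt q hq) (hle q hq p hlt'))

/-- Amalgamation of `T_P^0`-structures over an algebraically closed
base field, with independent (injective on the tensor product) amalgamation of fields. -/
theorem stmt13 {P : Type v} [PartialOrder P] [OrderBot P] [Fintype P]
    (htree : ∀ x : P, IsChain (· ≤ ·) {y : P | y ≤ x})
    {K0 K1 K2 : Type u} [Field K0] [Field K1] [Field K2] [IsAlgClosed K0]
    [Algebra K0 K1] [Algebra K0 K2]
    (s0 : TP0 P K0) (s1 : TP0 P K1) (s2 : TP0 P K2)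
    (h1 : TP0.Extends (algebraMap K0 K1) s0 s1)
    (h2 : TP0.Extends (algebraMap K0 K2) s0 s2) :
    ∃ (K3 : Type u) (_ : Field K3) (f1 : K1 →+* K3) (f2 : K2 →+* K3),
      f1.comp (algebraMap K0 K1) = f2.comp (algebraMap K0 K2) ∧
      (∃ F : (K1 ⊗[K0] K2) →+* K3,
        (∀ x y, F (x ⊗ₜ y) = f1 x * f2 y) ∧ Function.Injective F) ∧
      ∃ s3 : TP0 P K3, TP0.Extends f1 s1 s3 ∧ TP0.Extends f2 s2 s3 := by
  have := isDomain_tensorProduct_of_isAlgClosed K0 K1 K2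
  let K3 := FractionRing (K1 ⊗[K0] K2)
  let F : K1 ⊗[K0] K2 →+* K3 := algebraMap _ _
  have hF : Function.Injective F := IsFractionRing.injective _ _
  let f1 : K1 →+* K3 := F.comp Algebra.TensorProduct.includeLeftRingHom
  let f2 : K2 →+* K3 :=
    F.comp (Algebra.TensorProduct.includeRight : K2 →ₐ[K0] K1 ⊗[K0] K2).toRingHom
  have hmul : ∀ x y, F (x ⊗ₜ y) = f1 x * f2 y := fun x y ↦ by
    simp [f1, f2, ← map_mul]
  have hf : ∀ x, f1 (algebraMap K0 K1 x) = f2 (algebraMap K0 K2 x) := fun x ↦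
    congrArg F (Algebra.TensorProduct.tmul_one_eq_one_tmul (A := K1) (B := K2) x)
  have htop : IsDisjointExtension (s0.O ⊥) (s1.O ⊥) (s2.O ⊥) f1 f2 ⊤ := by
    rw [s0.bot_eq, s1.bot_eq, s2.bot_eq]
    refine isDisjointExtension_top fun n a b ha hab ↦ ?_
    refine TensorProduct.eq_zero_of_sum_tmul_eq_zero ha (hF ?_)
    simpa only [map_sum, hmul, map_zero] using hab
  obtain ⟨O, hbot, hO, hanti⟩ := exists_antitone_of_isChain htree
    (fun p V ↦ IsDisjointExtension (s0.O p) (s1.O p) (s2.O p) f1 f2 V) htop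
    (fun p q hpq V hV ↦ hV.exists_le hf (s1.antitone hpq.le) (s2.antitone hpq.le)
      (h1 p) (h1 q) (h2 q))
  exact ⟨K3, inferInstance, f1, f2, RingHom.ext hf, ⟨F, hmul, hF⟩, ⟨O, hbot, fun h ↦ hanti h⟩,
    fun p ↦ (hO p).comap_left, fun p ↦ (hO p).comap_right⟩
end

section
/- Let K be a field and let O_1, …, O_n be valuation subrings of K. Then there exist a field extension L of K and valuation subrings O'_1, …, O'_n of L such that: (1) L is algebraically closed; (2) O'_i ∩ K = O_i for each i; (3) each O'_i is non-trivial, i.e., O'_i ≠ L; and (4) the O'_i are pairwise independent, i.e., for all i ≠ j, every element of L can be written as a product a·b with a ∈ O'_i and b ∈ O'_j. -/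
universe u

open Polynomial

/-- A ring homomorphism `g` into a field whose kernel lies in the proper ideal `I` admits a
valuation subring of the field that contains the image of `g` and in which `g` maps `I` to
nonunits. -/
lemma RingHom.exists_valuationSubring_of_ker_le {T L : Type*} [CommRing T] [Field L]
    (g : T →+* L) (I : Ideal T) (hI : I ≠ ⊤) (hker : RingHom.ker g ≤ I) :
    ∃ V : ValuationSubring L, (∀ t, g t ∈ V) ∧ ∀ t ∈ I, g t ∈ V.nonunits := by
  have hJ : I.map g.rangeRestrict ≠ ⊤ := by
    rw [Ne, Ideal.eq_top_iff_one, Ideal.mem_map_iff_of_surjective _ g.rangeRestrict_surjective]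
    rintro ⟨t, ht, h1⟩
    have hg : g t = 1 := congrArg Subtype.val h1
    have hmem : 1 - t ∈ I := hker (by simp [RingHom.mem_ker, hg])
    exact hI ((Ideal.eq_top_iff_one I).2 (by simpa using I.add_mem hmem ht))
  obtain ⟨V, hV, hV'⟩ := Ideal.image_subset_nonunits_valuationSubring _ hJ
  exact ⟨V, fun t ↦ hV ⟨t, rfl⟩, fun t ht ↦ hV' ⟨_, Ideal.mem_map_of_mem _ ht, rfl⟩⟩

/-- A valuation subring `O` of `K` extends to any field `L` containing `F[X]`, for `F` an extension
of `K`, in such a way that the value of `X - c` is positive but infinitesimal. -/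
lemma ValuationSubring.exists_extension_at_point {K F L : Type*} [Field K] [Field F] [Field L]
    (O : ValuationSubring K) (f : K →+* F) (c : F) (g : F[X] →+* L)
    (hg : Function.Injective g) :
    ∃ V : ValuationSubring L, V.comap (g.comp (C.comp f)) = O ∧
      (∀ p, p.eval c = 0 → g p ∈ V.nonunits) ∧
      ∀ p q, p.eval c = 0 → q.eval c ≠ 0 → g p / g q ∈ V := by
  let T : Subring (F[X] × O) := RingHom.eqLocus ((evalRingHom c).comp (RingHom.fst F[X] O))
    ((f.comp O.subtype).comp (RingHom.snd F[X] O))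
  have hT (p : F[X]) (y : O) (h : p.eval c = f y) : (p, y) ∈ T := h
  let I : Ideal T := (IsLocalRing.maximalIdeal O).comap ((RingHom.snd F[X] O).comp T.subtype)
  have hker : RingHom.ker (g.comp ((RingHom.fst F[X] O).comp T.subtype)) ≤ I := by
    rintro ⟨⟨p, y⟩, h⟩ hp
    have hp0 : p = 0 := hg (by simpa [RingHom.mem_ker] using hp)
    have hy : p.eval c = f y := h
    have hy0 : y = 0 := by
      apply Subtype.ext
      apply f.injective
      simpa [hp0] using hy.symm
    change y ∈ IsLocalRing.maximalIdeal O
    simp [hy0]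
  have hI : I ≠ ⊤ := Ideal.comap_ne_top _ (IsLocalRing.maximalIdeal.isMaximal O).ne_top
  obtain ⟨V, hV, hVI⟩ := RingHom.exists_valuationSubring_of_ker_le _ I hI hker
  have mem (p : F[X]) (y : O) (h : p.eval c = f y) : g p ∈ V := hV ⟨(p, y), hT p y h⟩
  have non (p : F[X]) (y : O) (hy : y ∈ IsLocalRing.maximalIdeal O) (h : p.eval c = f y) :
      g p ∈ V.nonunits := hVI ⟨(p, y), hT p y h⟩ hy
  have non₀ (p : F[X]) (h : p.eval c = 0) : g p ∈ V.nonunits :=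
    non p 0 (Ideal.zero_mem _) (by simpa using h)
  refine ⟨V, ?_, non₀, fun p q hp hq ↦ ?_⟩
  · ext x
    simp only [ValuationSubring.mem_comap, RingHom.comp_apply]
    refine ⟨fun hx ↦ ?_, fun hx ↦ mem _ ⟨x, hx⟩ (by simp)⟩
    by_contra hxO
    have hx' : x⁻¹ ∈ O.nonunits := O.inv_mem_nonunits_iff.2 (.inr hxO)
    obtain ⟨h₁, h₂⟩ := O.mem_nonunits_iff_exists_mem_maximalIdeal.1 hx'
    have key := non (C (f x⁻¹)) _ h₂ (by simp)
    have hinv : g (C (f x⁻¹)) = (g (C (f x)))⁻¹ := map_inv₀ (g.comp (C.comp f)) x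
    rw [hinv, V.inv_mem_nonunits_iff] at key
    rcases key with h | h
    · have : x = 0 := (map_eq_zero (g.comp (C.comp f))).1 h
      exact hxO (this ▸ O.zero_mem)
    · exact h hx
  · set a := C (q.eval c)⁻¹
    have ha : g a ≠ 0 := by
      rw [map_ne_zero_iff _ hg]
      exact C_ne_zero.2 (inv_ne_zero hq)
    have hval : V.valuation (g (q * a)) = 1 := by
      have h := non₀ (q * a - 1) (by simp [a, hq])
      rw [ValuationSubring.mem_nonunits_iff] at h
      simpa using V.valuation.map_one_add_of_lt h
    rw [← mul_div_mul_right _ _ ha, ← map_mul, ← map_mul, ← V.valuation_le_one_iff, map_div₀, hval,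
      div_one, V.valuation_le_one_iff]
    exact ValuationSubring.nonunits_subset (non₀ (p * a) (by simp [hp]))

/-- If the powers of `π` absorb a subfield `E` into a valuation subring `V` of `L`, then they absorb
every element of `L` algebraic over `E`. -/
lemma ValuationSubring.exists_mul_pow_mem_of_isAlgebraic {E L : Type*} [Field E] [Field L]
    [Algebra E L] [Algebra.IsAlgebraic E L] (V : ValuationSubring L) {π : L} (hπ : π ∈ V)
    (hE : ∀ e : E, ∃ m : ℕ, algebraMap E L e * π ^ m ∈ V) (x : L) : ∃ m : ℕ, x * π ^ m ∈ V := by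
  let S : Subring L :=
    { carrier := {y | ∃ m : ℕ, y * π ^ m ∈ V}
      mul_mem' := by
        rintro a b ⟨k, hk⟩ ⟨l, hl⟩
        exact ⟨k + l, by convert V.mul_mem _ _ hk hl using 1; ring⟩
      one_mem' := ⟨0, by simp⟩
      add_mem' := by
        rintro a b ⟨k, hk⟩ ⟨l, hl⟩
        refine ⟨k + l, ?_⟩
        convert V.add_mem _ _ (V.mul_mem _ _ hk (pow_mem hπ l))
          (V.mul_mem _ _ hl (pow_mem hπ k)) using 1
        ring
      zero_mem' := ⟨0, by simp⟩
      neg_mem' := by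
        rintro a ⟨k, hk⟩
        exact ⟨k, by simpa using hk⟩ }
  let W : ValuationSubring L := V.ofLE S fun y hy ↦ ⟨0, by simpa using hy⟩
  have hx : IsIntegral W x :=
    (Algebra.IsIntegral.isIntegral (R := E) x).map_of_comp_eq
      ((algebraMap E L).codRestrict W.toSubring hE) (RingHom.id L) rfl
  obtain ⟨y, rfl⟩ := IsIntegrallyClosed.isIntegral_iff.1 hx
  exact y.2

/-- Finitely many valuation subrings of `K` extend to non-trivial, pairwise independent valuation
subrings of any algebraic extension `L` of the rational function field `E` over an infinite
extension `F` of `K`. -/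
lemma ValuationSubring.exists_independent_extensions {K F E L : Type*} [Field K] [Field F]
    [Infinite F] [Field E] [Algebra F[X] E] [IsFractionRing F[X] E] [Field L] [Algebra E L]
    [Algebra.IsAlgebraic E L] (f : K →+* F) {n : ℕ} (O : Fin n → ValuationSubring K) :
    ∃ (h : K →+* L) (O' : Fin n → ValuationSubring L),
      (∀ i, (O' i).comap h = O i) ∧
      (∀ i, O' i ≠ ⊤) ∧
      (∀ i j, i ≠ j → ∀ x : L, ∃ a b : L, a ∈ O' i ∧ b ∈ O' j ∧ x = a * b) := by
  let c : Fin n ↪ F := Fin.valEmbedding.trans (Infinite.natEmbedding F)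
  let g : F[X] →+* L := (algebraMap E L).comp (algebraMap F[X] E)
  have hg : Function.Injective g :=
    (algebraMap E L).injective.comp (IsFractionRing.injective F[X] E)
  choose V hVO hnon hdiv using fun i ↦
    (O i).exists_extension_at_point f (c i) g hg
  let π (i : Fin n) : L := g (X - C (c i))
  have hπ₀ (i) : π i ≠ 0 := (map_ne_zero_iff _ hg).2 (X_sub_C_ne_zero _)
  have hπ (i) : π i ∈ (V i).nonunits := hnon i _ (by simp)
  have hE (i) (e : E) : ∃ m : ℕ, algebraMap E L e * π i ^ m ∈ V i := by
    obtain ⟨p, q, hq, rfl⟩ := IsFractionRing.div_surjective (A := F[X]) e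
    have hq₀ : q ≠ 0 := nonZeroDivisors.ne_zero hq
    obtain ⟨u, hu, hdvd⟩ := q.exists_eq_pow_rootMultiplicity_mul_and_not_dvd hq₀ (c i)
    set k := q.rootMultiplicity (c i)
    refine ⟨k + 1, ?_⟩
    convert hdiv i (p * (X - C (c i))) u (by simp) (by rwa [dvd_iff_isRoot] at hdvd) using 1
    have hu₀ : g u ≠ 0 := by
      rw [map_ne_zero_iff _ hg]
      rintro rfl
      simp at hdvd
    have hgq : algebraMap E L (algebraMap F[X] E q) = π i ^ k * g u := by
      change g q = _
      conv_lhs => rw [hu]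
      simp [π]
    rw [map_div₀, hgq, map_mul]
    change g p / _ * _ = _ * π i / _
    have := hπ₀ i
    field_simp
    ring
  refine ⟨g.comp (C.comp f), V, hVO, fun i hi ↦ ?_, fun i j hij x ↦ ?_⟩
  · rcases (V i).mem_nonunits_iff_or.1 (hπ i) with h | h
    · exact hπ₀ i h
    · exact h (hi ▸ ValuationSubring.mem_top _)
  · obtain ⟨m, hm⟩ := (V i).exists_mul_pow_mem_of_isAlgebraic
      (ValuationSubring.nonunits_subset (hπ i)) (hE i) x
    have hi : π i / π j ∈ V i :=
      hdiv i _ _ (by simp) (by simpa [sub_eq_zero] using hij)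
    have hj : π j / π i ^ 2 ∈ V j := by
      rw [← map_pow]
      exact hdiv j _ _ (by simp) (by simpa [sub_eq_zero] using hij.symm)
    refine ⟨x * π i ^ m * (π i / π j) ^ m, (π j / π i ^ 2) ^ m, (V i).mul_mem _ _ hm (pow_mem hi m),
      pow_mem hj m, ?_⟩
    have h : π i * (π i / π j) * (π j / π i ^ 2) = 1 := by
      have h₁ := hπ₀ i
      have h₂ := hπ₀ j
      field_simp
    rw [mul_assoc, mul_assoc, ← mul_pow, ← mul_pow, ← mul_assoc, h, one_pow, mul_one]

/-- Any field with `n` valuation subrings embeds in an algebraically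
closed field with `n` extensions of the valuation subrings which are non-trivial and
pairwise independent. -/
theorem stmt14 {K : Type u} [Field K] (n : ℕ) (O : Fin n → ValuationSubring K) :
    ∃ (L : Type u) (_ : Field L) (f : K →+* L) (O' : Fin n → ValuationSubring L),
      IsAlgClosed L ∧
      (∀ i, (O' i).comap f = O i) ∧
      (∀ i, O' i ≠ ⊤) ∧
      (∀ i j, i ≠ j → ∀ x : L, ∃ a b : L, a ∈ O' i ∧ b ∈ O' j ∧ x = a * b) := by
  have : Infinite (AlgebraicClosure K) := IsAlgClosed.instInfinite
  let E := FractionRing (AlgebraicClosure K)[X]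
  obtain ⟨h, O', hO'⟩ := ValuationSubring.exists_independent_extensions (E := E)
    (L := AlgebraicClosure E) (algebraMap K (AlgebraicClosure K)) O
  exact ⟨AlgebraicClosure E, inferInstance, h, O', inferInstance, hO'⟩
end

section
/- Let R be a unique factorization domain with fraction field F, let p be a prime number different from the characteristic of F, and suppose R contains a primitive p-th root of unity. Let q_1, …, q_n be elements of R generating pairwise distinct prime ideals (i.e., each q_i is a prime element of R and the ideals (q_i) are distinct). Then the quotient ring R[X_1, …, X_n]/(X_1^p − q_1, …, X_n^p − q_n) is an integral domain. -/
universe u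

/-- **Kummer theory**: if `F` contains a primitive `p`-th root of unity, then nonzero elements of a
Galois extension whose `p`-th powers lie in `F` and whose pairwise ratios do not lie in `F` are
linearly independent over `F`. -/
theorem linearIndependent_of_pow_mem_of_div_notMem {F K ι : Type*} [Field F] [Field K]
    [Algebra F K] [IsGalois F K] {p : ℕ} [NeZero p] {ζ : F} (hζ : IsPrimitiveRoot ζ p)
    (β : ι → K) (hβ₀ : ∀ i, β i ≠ 0) (hβ : ∀ i, β i ^ p ∈ (algebraMap F K).range)
    (hdiv : ∀ i j, i ≠ j → β i / β j ∉ (algebraMap F K).range) :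
    LinearIndependent F β := by
  have hfix (i : ι) (σ τ : K ≃ₐ[F] K) : σ (τ (β i) / β i) = τ (β i) / β i := by
    obtain ⟨a, ha⟩ := hβ i
    have hpow : (τ (β i) / β i) ^ p = 1 := by
      rw [div_pow, ← map_pow, ← ha, AlgEquiv.commutes, ha, div_self (pow_ne_zero _ (hβ₀ i))]
    obtain ⟨k, -, hk⟩ :=
      (hζ.map_of_injective (algebraMap F K).injective).eq_pow_of_pow_eq_one hpow
    rw [← hk, map_pow, AlgEquiv.commutes]
  let χ (i : ι) : (K ≃ₐ[F] K) →* K :=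
    { toFun := fun σ => σ (β i) / β i
      map_one' := div_self (hβ₀ i)
      map_mul' := fun σ τ => by
        have h : σ (τ (β i)) = τ (β i) / β i * σ (β i) := by
          rw [← hfix i σ τ, ← map_mul, div_mul_cancel₀ _ (hβ₀ i)]
        rw [AlgEquiv.mul_apply, h]
        ring }
  have hχ : Function.Injective χ := by
    intro i j hij
    by_contra hne
    refine hdiv i j hne ((InfiniteGalois.mem_range_algebraMap_iff_fixed _).2 fun σ => ?_)
    have h : σ (β i) / β i = σ (β j) / β j := DFunLike.congr_fun hij σ
    have hσ : σ (β j) ≠ 0 := (map_ne_zero σ).2 (hβ₀ j)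
    have hi := hβ₀ i
    have hj := hβ₀ j
    rw [map_div₀]
    field_simp at h ⊢
    linear_combination h
  have hli := (linearIndependent_monoidHom (K ≃ₐ[F] K) K).comp χ hχ
  rw [linearIndependent_iff'] at hli ⊢
  intro s g hg i hi
  have h := hli s (fun j => algebraMap F K (g j) * β j) (by
    ext σ
    have hσ := congrArg σ hg
    simp only [map_sum, map_zero, Algebra.smul_def, map_mul, AlgEquiv.commutes] at hσ
    simp only [Finset.sum_apply, Pi.smul_apply, Function.comp_apply, smul_eq_mul, Pi.zero_apply]
    rw [← hσ]
    refine Finset.sum_congr rfl fun j _ => ?_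
    change _ * _ * (σ (β j) / β j) = _
    have hj := hβ₀ j
    field_simp) i hi
  simpa [hβ₀ i] using h

/-- Let `q` be a family of pairwise non-associated primes. If `∏ q j ^ e j` and `∏ q j ^ f j` agree
up to nonzero `p`-th powers, then `e` and `f` agree modulo `p`. -/
theorem modEq_of_prod_pow_mul_pow_eq {R ι : Type*} [CommRing R] [IsDomain R]
    [UniqueFactorizationMonoid R] [Fintype ι] {q : ι → R} (hq : ∀ i, Prime (q i))
    (hdist : ∀ i j, i ≠ j → ¬ Associated (q i) (q j)) {p : ℕ} {e f : ι → ℕ} {a b : R}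
    (ha : a ≠ 0) (hb : b ≠ 0)
    (h : (∏ j, q j ^ e j) * a ^ p = (∏ j, q j ^ f j) * b ^ p) (i : ι) : e i ≡ f i [MOD p] := by
  classical
  have hself : emultiplicity (q i) (q i) = 1 := by
    simpa using emultiplicity_pow_self (hq i).ne_zero (hq i).not_isUnit 1
  have hprod (g : ι → ℕ) : emultiplicity (q i) (∏ j, q j ^ g j) = g i := by
    rw [Finset.emultiplicity_prod (hq i), Finset.sum_eq_single i]
    · rw [emultiplicity_pow (hq i), hself, mul_one]
    · intro j _ hj
      rw [emultiplicity_eq_zero]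
      intro hdvd
      exact hdist i j hj.symm
        ((hq i).associated_of_dvd (hq j) ((hq i).dvd_of_dvd_pow hdvd))
    · simp
  have hmul := congrArg (emultiplicity (q i)) h
  rw [emultiplicity_mul (hq i), emultiplicity_mul (hq i), emultiplicity_pow (hq i),
    emultiplicity_pow (hq i), hprod, hprod,
    (FiniteMultiplicity.of_prime_left (hq i) ha).emultiplicity_eq_multiplicity,
    (FiniteMultiplicity.of_prime_left (hq i) hb).emultiplicity_eq_multiplicity] at hmul
  have hnat : e i + p * multiplicity (q i) a = f i + p * multiplicity (q i) b := by
    exact_mod_cast hmul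
  simpa [Nat.ModEq] using congrArg (· % p) hnat

/-- The monomials with all exponents less than `p` span
`R[X_i : i ∈ ι] / (X_i ^ p - q_i : i ∈ ι)`. -/
theorem MvPolynomial.span_range_mk_prod_X_pow_eq_top {R ι : Type*} [CommRing R] [Fintype ι]
    {p : ℕ} (hp : 0 < p) (q : ι → R) :
    Submodule.span R (Set.range fun e : ι → Fin p =>
      Ideal.Quotient.mk (Ideal.span (Set.range fun i => X i ^ p - C (q i)))
        (∏ i, X i ^ (e i : ℕ))) = ⊤ := by
  set I : Ideal (MvPolynomial ι R) := Ideal.span (Set.range fun i => X i ^ p - C (q i)) with hI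
  have hX (i : ι) (d : ℕ) : Ideal.Quotient.mk I (X i ^ d) =
      Ideal.Quotient.mk I (C (q i ^ (d / p)) * X i ^ (d % p)) := by
    have h : Ideal.Quotient.mk I (X i) ^ p = Ideal.Quotient.mk I (C (q i)) := by
      rw [← map_pow]
      exact Ideal.Quotient.eq.2 (Ideal.subset_span ⟨i, rfl⟩)
    conv_lhs => rw [← Nat.div_add_mod d p]
    rw [pow_add, pow_mul]
    simp only [map_mul, map_pow, h]
  rw [eq_top_iff]
  rintro x -
  obtain ⟨P, rfl⟩ := Ideal.Quotient.mk_surjective x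
  induction P using MvPolynomial.induction_on' with
  | add P Q hP hQ =>
    rw [map_add]
    exact Submodule.add_mem _ hP hQ
  | monomial d c =>
    have h : Ideal.Quotient.mk I (monomial d c) = (c * ∏ i, q i ^ (d i / p)) •
        Ideal.Quotient.mk I (∏ i, X i ^ (d i % p)) := by
      rw [monomial_eq, Finsupp.prod_fintype _ _ fun i => pow_zero _, map_mul, map_prod,
        Finset.prod_congr rfl fun i _ => hX i (d i), ← map_prod, Finset.prod_mul_distrib,
        ← map_prod, ← map_mul, ← mul_assoc, ← C_mul, ← smul_eq_C_mul]
      rfl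
    rw [h]
    exact Submodule.smul_mem _ _
      (Submodule.subset_span ⟨fun i => ⟨d i % p, Nat.mod_lt _ hp⟩, rfl⟩)

/-- If `R` is a UFD whose fraction field has characteristic different
from the prime `p`, containing a primitive `p`-th root of unity, and `q 0, …, q (n-1)`
are prime elements of `R` generating pairwise distinct (prime) ideals, then
`R[X_1, …, X_n]/(X_1^p − q_1, …, X_n^p − q_n)` is an integral domain. -/
theorem stmt15 {R : Type u} [CommRing R] [IsDomain R] [UniqueFactorizationMonoid R]
    (p : ℕ) (hp : p.Prime) (hchar : ringChar (FractionRing R) ≠ p)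
    (ζ : R) (hζ : IsPrimitiveRoot ζ p)
    (n : ℕ) (q : Fin n → R) (hq : ∀ i, Prime (q i))
    (hdist : ∀ i j, i ≠ j → Ideal.span {q i} ≠ Ideal.span {q j}) :
    IsDomain (MvPolynomial (Fin n) R ⧸
      Ideal.span (Set.range fun i => MvPolynomial.X i ^ p - MvPolynomial.C (q i))) := by
  have hp0 : NeZero p := ⟨hp.ne_zero⟩
  let F := FractionRing R
  let K := SeparableClosure F
  have hpF : (p : F) ≠ 0 := fun h =>
    ((Nat.dvd_prime hp).1 (ringChar.dvd h)).elim CharP.ringChar_ne_one hchar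
  have hpK : NeZero (p : K) := ⟨by
    rw [← map_natCast (algebraMap F K)]
    exact (map_ne_zero _).2 hpF⟩
  have hinj : Function.Injective (algebraMap R K) := by
    rw [IsScalarTower.algebraMap_eq R F K]
    exact (algebraMap F K).injective.comp (IsFractionRing.injective R F)
  choose α hα using fun i => IsSepClosed.exists_pow_nat_eq (algebraMap R K (q i)) p
  have hα₀ (i : Fin n) : α i ≠ 0 := by
    intro h
    have h0 := hα i
    rw [h, zero_pow hp.ne_zero, eq_comm, map_eq_zero_iff _ hinj] at h0
    exact (hq i).ne_zero h0
  let β (e : Fin n → Fin p) : K := ∏ i, α i ^ (e i : ℕ)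
  have hβ₀ (e : Fin n → Fin p) : β e ≠ 0 :=
    Finset.prod_ne_zero_iff.2 fun i _ => pow_ne_zero _ (hα₀ i)
  have hβ (e : Fin n → Fin p) : β e ^ p = algebraMap R K (∏ i, q i ^ (e i : ℕ)) := by
    simp only [β, ← Finset.prod_pow, map_prod, map_pow, ← hα, ← pow_mul, mul_comm]
  have hassoc (i j : Fin n) (hij : i ≠ j) : ¬ Associated (q i) (q j) := fun h =>
    hdist i j hij (Ideal.span_singleton_eq_span_singleton.2 h)
  have hβF : LinearIndependent F β := by
    refine linearIndependent_of_pow_mem_of_div_notMem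
      (hζ.map_of_injective (IsFractionRing.injective R F)) β hβ₀
      (fun e => ⟨algebraMap R F _, ((hβ e).trans (IsScalarTower.algebraMap_apply R F K _)).symm⟩) ?_
    rintro e f hef ⟨x, hx⟩
    obtain ⟨a, b, hb, rfl⟩ := IsFractionRing.div_surjective (A := R) x
    have hb₀ : b ≠ 0 := nonZeroDivisors.ne_zero hb
    have hbK : algebraMap R K b ≠ 0 := (map_ne_zero_iff _ hinj).2 hb₀
    rw [map_div₀, ← IsScalarTower.algebraMap_apply, ← IsScalarTower.algebraMap_apply,
      div_eq_div_iff hbK (hβ₀ f)] at hx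
    have ha₀ : a ≠ 0 := by
      rintro rfl
      rw [map_zero, zero_mul] at hx
      exact mul_ne_zero (hβ₀ e) hbK hx.symm
    have hR : (∏ i, q i ^ (e i : ℕ)) * b ^ p = (∏ i, q i ^ (f i : ℕ)) * a ^ p := by
      apply hinj
      rw [map_mul, map_mul, ← hβ, ← hβ, map_pow, map_pow, ← mul_pow, ← mul_pow, ← hx, mul_comm]
    refine hef (funext fun i => Fin.ext ?_)
    exact (modEq_of_prod_pow_mul_pow_eq hq hassoc hb₀ ha₀ hR i).eq_of_lt_of_lt (e i).2 (f i).2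
  have hβR : LinearIndependent R β := (LinearIndependent.iff_fractionRing R F).2 hβF
  set I : Ideal (MvPolynomial (Fin n) R) :=
    Ideal.span (Set.range fun i => MvPolynomial.X i ^ p - MvPolynomial.C (q i)) with hI
  let φ : (MvPolynomial (Fin n) R ⧸ I) →ₐ[R] K :=
    Ideal.Quotient.liftₐ I (MvPolynomial.aeval α) fun x hx => by
      have hle : I ≤ RingHom.ker (MvPolynomial.aeval (R := R) α) := by
        rw [hI, Ideal.span_le]
        rintro _ ⟨i, rfl⟩
        simp [RingHom.mem_ker, hα]
      exact hle hx
  have hφ (e : Fin n → Fin p) :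
      φ (Ideal.Quotient.mk I (∏ i, MvPolynomial.X i ^ (e i : ℕ))) = β e := by
    change MvPolynomial.aeval α _ = _
    simp [β]
  have hφinj : Function.Injective φ := by
    rw [injective_iff_map_eq_zero]
    intro x hx
    have hmem : x ∈ Submodule.span R (Set.range fun e : Fin n → Fin p =>
        Ideal.Quotient.mk I (∏ i, MvPolynomial.X i ^ (e i : ℕ))) := by
      rw [MvPolynomial.span_range_mk_prod_X_pow_eq_top hp.pos q]
      exact Submodule.mem_top
    obtain ⟨c, rfl⟩ := (Submodule.mem_span_range_iff_exists_fun R).1 hmem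
    simp only [map_sum, map_smul, hφ] at hx
    have hc := Fintype.linearIndependent_iff.1 hβR c hx
    simp [hc]
  exact hφinj.isDomain φ.toRingHom
end

section
/- Let R be a unique factorization domain with fraction field F, let p be a prime number different from the characteristic of F, and suppose F contains a primitive p-th root of unity. Let q_1, …, q_n be elements of R generating pairwise distinct prime ideals (i.e., each q_i is a prime element of R and the ideals (q_i) are distinct). Let t_1, …, t_n be elements of an algebraic closure of F with t_i^p = q_i for each i. Then the field L = F(t_1, …, t_n) satisfies [L : F] = p^n. -/
universe u

open Polynomial IntermediateField in
theorem irreducible_X_pow_sub_C_of_root_notMem_bot {K L : Type*} [Field K] [Field L] [Algebra K L]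
    {p : ℕ} (hp : p.Prime) {ζ : K} (hζ : IsPrimitiveRoot ζ p) {a : K} {t : L}
    (ht : t ^ p = algebraMap K L a) (hbot : t ∉ (⊥ : IntermediateField K L)) :
    Irreducible (X ^ p - C a) := by
  have : NeZero p := ⟨hp.ne_zero⟩
  refine X_pow_sub_C_irreducible_of_prime hp fun b hb ↦ hbot ?_
  have hb0 : algebraMap K L b ≠ 0 := by
    intro h
    have hb' : b = 0 := by simpa using h
    rw [← hb, hb', zero_pow hp.ne_zero, map_zero] at ht
    rw [eq_zero_of_pow_eq_zero ht] at hbot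
    exact hbot (zero_mem _)
  obtain ⟨i, -, hi⟩ := (hζ.map_of_injective (algebraMap K L).injective).eq_pow_of_pow_eq_one
    (ξ := t / algebraMap K L b) (by
      rw [div_pow, ht, ← hb, map_pow, div_self (pow_ne_zero _ hb0)])
  refine IntermediateField.mem_bot.2 ⟨ζ ^ i * b, ?_⟩
  rw [map_mul, map_pow, hi, div_mul_cancel₀ _ hb0]

open Polynomial IntermediateField in
theorem finrank_adjoin_simple_of_irreducible_X_pow_sub_C {K L : Type*} [Field K] [Field L]
    [Algebra K L] {n : ℕ} (hn : n ≠ 0) {a : K} {t : L} (ht : t ^ n = algebraMap K L a)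
    (h : Irreducible (X ^ n - C a)) : Module.finrank K K⟮t⟯ = n := by
  have hmonic := monic_X_pow_sub_C a hn
  have hroot : aeval t (X ^ n - C a) = 0 := by simp [ht]
  rw [adjoin.finrank ⟨_, hmonic, hroot⟩, ← minpoly.eq_of_irreducible_of_monic h hroot hmonic,
    natDegree_X_pow_sub_C]

open Polynomial IntermediateField in
/-- In a Kummer extension `K⟮t⟯ / K` of prime exponent `p`, every `p`-th root of an element of `K`
is a multiple of a power of `t` by an element of `K`. -/
theorem exists_eq_mul_pow_of_pow_mem_bot {K L : Type*} [Field K] [Field L] [Algebra K L]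
    {p : ℕ} (hp : p.Prime) {ζ : K} (hζ : IsPrimitiveRoot ζ p) {t x : L}
    (ht : t ^ p ∈ (⊥ : IntermediateField K L)) (hx : x ∈ K⟮t⟯)
    (hxp : x ^ p ∈ (⊥ : IntermediateField K L)) :
    ∃ (c : K) (k : ℕ), x = algebraMap K L c * t ^ k := by
  by_cases hbot : t ∈ (⊥ : IntermediateField K L)
  · rw [adjoin_simple_eq_bot_iff.2 hbot] at hx
    obtain ⟨c, rfl⟩ := IntermediateField.mem_bot.1 hx
    exact ⟨c, 0, by simp⟩
  obtain ⟨a, ha⟩ := IntermediateField.mem_bot.1 ht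
  obtain ⟨b, hb⟩ := IntermediateField.mem_bot.1 hxp
  have : NeZero p := ⟨hp.ne_zero⟩
  have : Fact p.Prime := ⟨hp⟩
  have hirr := irreducible_X_pow_sub_C_of_root_notMem_bot hp hζ ha.symm hbot
  have hrank := finrank_adjoin_simple_of_irreducible_X_pow_sub_C hp.ne_zero ha.symm hirr
  have hint : IsIntegral K t := ⟨_, monic_X_pow_sub_C a hp.ne_zero, by simp [ha]⟩
  have : FiniteDimensional K K⟮t⟯ := adjoin.finiteDimensional hint
  let g : K⟮t⟯ := AdjoinSimple.gen K t
  have hgen : K⟮g⟯ = ⊤ := lift_injective _ (by rw [lift_adjoin_simple, lift_top]; rfl)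
  have hgp : g ^ p = algebraMap K K⟮t⟯ a := Subtype.ext ha.symm
  have hprim : (primitiveRoots p K).Nonempty := ⟨ζ, (mem_primitiveRoots hp.pos).2 hζ⟩
  have : IsSplittingField K K⟮t⟯ (X ^ p - C a) := by
    have := isSplittingField_X_pow_sub_C_of_root_adjoin_eq_top (K := K) (L := K⟮t⟯) (a := a)
      (α := g) (by rwa [hrank]) (by rw [hrank]; exact hgp) hgen
    rwa [hrank] at this
  have : IsGalois K K⟮t⟯ := isGalois_of_isSplittingField_X_pow_sub_C hprim hirr _
  have hcard : Nat.card Gal(K⟮t⟯/K) = p := (IsGalois.card_aut_eq_finrank _ _).trans hrank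
  have hg0 : g ≠ 0 := fun h ↦ hbot (by
    have : t = 0 := congrArg Subtype.val h
    rw [this]; exact zero_mem _)
  obtain ⟨σ, hσ⟩ : ∃ σ : Gal(K⟮t⟯/K), σ g ≠ g := by
    by_contra! h
    obtain ⟨c, hc⟩ := IntermediateField.mem_bot.1 ((IsGalois.mem_bot_iff_fixed g).2 h)
    exact hbot (IntermediateField.mem_bot.2 ⟨c, congrArg Subtype.val hc⟩)
  have hfix (z : K⟮t⟯) (hz : σ z = z) : z ∈ (⊥ : IntermediateField K K⟮t⟯) := by
    refine (IsGalois.mem_bot_iff_fixed z).2 fun τ ↦ ?_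
    have hσ1 : σ ≠ 1 := fun h ↦ hσ (by rw [h]; rfl)
    have hτ : τ ∈ Subgroup.zpowers σ := by
      rw [zpowers_eq_top_of_prime_card hcard hσ1]; exact Subgroup.mem_top _
    have hle : Subgroup.zpowers σ ≤ MulAction.stabilizer Gal(K⟮t⟯/K) z := by
      rw [Subgroup.zpowers_le]; exact hz
    exact hle hτ
  have hroot (z : K⟮t⟯) (hz0 : z ≠ 0) (r : K) (hz : z ^ p = algebraMap K _ r) :
      (σ z / z) ^ p = 1 := by
    rw [div_pow, ← map_pow, hz, AlgEquiv.commutes, ← hz, div_self (pow_ne_zero _ hz0)]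
  have hη : IsPrimitiveRoot (σ g / g) p :=
    IsPrimitiveRoot.iff_orderOf.2 <| orderOf_eq_prime (hroot g hg0 a hgp)
      fun h ↦ hσ ((div_eq_one_iff_eq hg0).1 h)
  by_cases hx0 : x = 0
  · exact ⟨0, 0, by simp [hx0]⟩
  let y : K⟮t⟯ := ⟨x, hx⟩
  have hy0 : y ≠ 0 := fun h ↦ hx0 (congrArg Subtype.val h)
  obtain ⟨k, -, hk⟩ := hη.eq_pow_of_pow_eq_one (hroot y hy0 b (Subtype.ext hb.symm))
  obtain ⟨c, hc⟩ := IntermediateField.mem_bot.1 <| hfix (y / g ^ k) (by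
    have hσg : σ g ≠ 0 := by simpa using hg0
    rw [map_div₀, map_pow, div_eq_div_iff (pow_ne_zero _ hσg) (pow_ne_zero _ hg0)]
    rw [div_pow, div_eq_div_iff (pow_ne_zero _ hg0) hy0] at hk
    rw [← hk, mul_comm])
  refine ⟨c, k, ?_⟩
  have : y = algebraMap K _ c * g ^ k := by rw [hc, div_mul_cancel₀ _ (pow_ne_zero _ hg0)]
  exact congrArg Subtype.val this

open IntermediateField in
/-- A `p`-th root of an element of `K` lying in the Kummer extension `K(t i | i ∈ s)` is a multiple
of a monomial in the `t i` by an element of `K`. -/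
theorem exists_eq_mul_prod_pow_of_pow_mem_bot {K L ι : Type*} [Field K] [Field L] [Algebra K L]
    {p : ℕ} (hp : p.Prime) {ζ : K} (hζ : IsPrimitiveRoot ζ p) {t : ι → L}
    (ht0 : ∀ i, t i ≠ 0) (ht : ∀ i, t i ^ p ∈ (⊥ : IntermediateField K L)) (s : Finset ι) {x : L}
    (hx : x ∈ adjoin K (t '' s)) (hxp : x ^ p ∈ (⊥ : IntermediateField K L)) :
    ∃ (c : K) (e : ι → ℕ), x = algebraMap K L c * ∏ i ∈ s, t i ^ e i := by
  classical
  induction s using Finset.induction_on generalizing x with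
  | empty =>
    rw [Finset.coe_empty, Set.image_empty, adjoin_empty] at hx
    obtain ⟨c, rfl⟩ := IntermediateField.mem_bot.1 hx
    exact ⟨c, 0, by simp⟩
  | insert i s hi ih =>
    have hbot {z : L} (hz : z ∈ (⊥ : IntermediateField K L)) :
        z ∈ (⊥ : IntermediateField (adjoin K (t '' s)) L) := by
      obtain ⟨c, rfl⟩ := IntermediateField.mem_bot.1 hz
      exact IntermediateField.mem_bot.2 ⟨algebraMap K _ c, rfl⟩
    rw [Finset.coe_insert, Set.image_insert_eq, ← Set.union_singleton, ← adjoin_adjoin_left,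
      mem_restrictScalars] at hx
    obtain ⟨c, k, rfl⟩ := exists_eq_mul_pow_of_pow_mem_bot hp
      (hζ.map_of_injective (algebraMap K (adjoin K (t '' s))).injective) (hbot (ht i)) hx (hbot hxp)
    have hcp : (c : L) ^ p ∈ (⊥ : IntermediateField K L) := by
      have hc : (c : L) ^ p = (c * t i ^ k) ^ p / (t i ^ p) ^ k := by
        rw [mul_pow, ← pow_mul, ← pow_mul, mul_comm k p,
          mul_div_cancel_right₀ _ (pow_ne_zero _ (ht0 i))]
      rw [hc]
      exact div_mem hxp (pow_mem (ht i) k)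
    obtain ⟨d, e, hd⟩ := ih c.2 hcp
    refine ⟨d, Function.update e i k, ?_⟩
    rw [Finset.prod_insert hi, Function.update_self, Finset.prod_congr rfl fun j hj ↦ by
      rw [Function.update_of_ne (ne_of_mem_of_not_mem hj hi)], mul_left_comm, ← hd, mul_comm]
    rfl

open IntermediateField in
/-- Degree of a multi-Kummer extension of prime exponent `p`: if no `a i` is, up to a `p`-th power,
a monomial in the other `a j`, then adjoining `p`-th roots of the `a i` for `i ∈ s` gives an
extension of degree `p ^ #s`. -/
theorem finrank_adjoin_image_eq_prime_pow_card {K L ι : Type*} [Field K] [Field L] [Algebra K L]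
    {p : ℕ} (hp : p.Prime) {ζ : K} (hζ : IsPrimitiveRoot ζ p) {a : ι → K} (ha0 : ∀ i, a i ≠ 0)
    {t : ι → L} (ht : ∀ i, t i ^ p = algebraMap K L (a i))
    (hindep : ∀ (s : Finset ι) (i : ι), i ∉ s → ∀ (c : K) (e : ι → ℕ),
      a i ≠ c ^ p * ∏ j ∈ s, a j ^ e j) (s : Finset ι) :
    Module.finrank K (adjoin K (t '' s)) = p ^ s.card := by
  classical
  have ht0 (i : ι) : t i ≠ 0 := by
    intro h
    have hi := ht i
    rw [h, zero_pow hp.ne_zero] at hi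
    exact ha0 i (by simpa using hi.symm)
  have htp (i : ι) : t i ^ p ∈ (⊥ : IntermediateField K L) :=
    IntermediateField.mem_bot.2 ⟨a i, (ht i).symm⟩
  induction s using Finset.induction_on with
  | empty => rw [Finset.coe_empty, Set.image_empty, adjoin_empty]; simp
  | insert i s hi ih =>
    rw [Finset.coe_insert, Set.image_insert_eq, ← Set.union_singleton, ← adjoin_adjoin_left,
      Finset.card_insert_of_notMem hi, pow_succ, ← ih]
    have hnot : t i ∉ (⊥ : IntermediateField (adjoin K (t '' s)) L) := by
      intro h
      obtain ⟨z, hz⟩ := IntermediateField.mem_bot.1 h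
      obtain ⟨c, e, hce⟩ := exists_eq_mul_prod_pow_of_pow_mem_bot hp hζ ht0 htp s
        (hz ▸ z.2 : t i ∈ adjoin K (t '' s)) (htp i)
      refine hindep s i hi c e ((algebraMap K L).injective ?_)
      rw [← ht i, hce, mul_pow, map_mul, map_pow, map_prod, ← Finset.prod_pow]
      congr 1
      refine Finset.prod_congr rfl fun j _ ↦ ?_
      rw [map_pow, ← ht j, ← pow_mul, ← pow_mul, mul_comm]
    have hti : t i ^ p = algebraMap (adjoin K (t '' s)) L (algebraMap K _ (a i)) := ht i
    have hrank := finrank_adjoin_simple_of_irreducible_X_pow_sub_C hp.ne_zero hti <|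
      irreducible_X_pow_sub_C_of_root_notMem_bot hp
        (hζ.map_of_injective (algebraMap K (adjoin K (t '' s))).injective) hti hnot
    have hmul := Module.finrank_mul_finrank K (adjoin K (t '' s))
      (adjoin (adjoin K (t '' s)) {t i})
    rw [hrank] at hmul
    exact hmul.symm

/-- In the fraction field of a UFD, a prime element is not the product of an `n`-th power, `n ≥ 2`,
and an element of the ring which it does not divide. -/
theorem Prime.algebraMap_ne_pow_mul {R K : Type*} [CommRing R] [IsDomain R]
    [UniqueFactorizationMonoid R] [Field K] [Algebra R K] [IsFractionRing R K] {q m : R}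
    (hq : Prime q) (hm : ¬ q ∣ m) {n : ℕ} (hn : 2 ≤ n) (c : K) :
    algebraMap R K q ≠ c ^ n * algebraMap R K m := by
  intro h
  set u := IsFractionRing.num R c with hu
  set v : R := (IsFractionRing.den R c : R) with hv
  have hv0 : algebraMap R K v ≠ 0 :=
    IsFractionRing.to_map_ne_zero_of_mem_nonZeroDivisors (IsFractionRing.den R c).2
  have huv : algebraMap R K v * c = algebraMap R K u := by
    rw [← IsFractionRing.mk'_num_den R c, IsFractionRing.mk'_eq_div, ← hu, ← hv]
    field_simp
  have heq : v ^ n * q = u ^ n * m := by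
    apply IsFractionRing.injective R K
    rw [map_mul, map_mul, map_pow, map_pow, h, ← mul_assoc, ← mul_pow, huv]
  have hqu : q ∣ u := by
    refine hq.dvd_of_dvd_pow ((hq.dvd_or_dvd (a := u ^ n) (b := m) ?_).resolve_right hm)
    exact heq ▸ dvd_mul_left _ _
  have hqv : q ∣ v := by
    refine hq.dvd_of_dvd_pow (n := n) ((mul_dvd_mul_iff_right hq.ne_zero).1 ?_)
    rw [heq, ← sq]
    exact (pow_dvd_pow_of_dvd hqu 2).trans ((pow_dvd_pow u hn).trans (dvd_mul_right _ _))
  exact hq.not_isUnit (IsFractionRing.num_den_reduced R c hqu hqv)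

/-- If `R` is a UFD whose fraction field `F` has characteristic
different from the prime `p` and contains a primitive `p`-th root of unity, and
`q 0, …, q (n-1)` are prime elements of `R` generating pairwise distinct ideals, and
`t i` is a `p`-th root of `q i` in an algebraic closure of `F`, then
`[F(t_1, …, t_n) : F] = p ^ n`. -/
theorem stmt16 {R : Type u} [CommRing R] [IsDomain R] [UniqueFactorizationMonoid R]
    (p : ℕ) (hp : p.Prime) (hchar : ringChar (FractionRing R) ≠ p)
    (ζ : FractionRing R) (hζ : IsPrimitiveRoot ζ p)
    (n : ℕ) (q : Fin n → R) (hq : ∀ i, Prime (q i))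
    (hdist : ∀ i j, i ≠ j → Ideal.span {q i} ≠ Ideal.span {q j})
    (t : Fin n → AlgebraicClosure (FractionRing R))
    (ht : ∀ i, t i ^ p =
      algebraMap (FractionRing R) (AlgebraicClosure (FractionRing R))
        (algebraMap R (FractionRing R) (q i))) :
    Module.finrank (FractionRing R)
      (IntermediateField.adjoin (FractionRing R) (Set.range t)) = p ^ n := by
  rw [← Set.image_univ, ← Finset.coe_univ,
    finrank_adjoin_image_eq_prime_pow_card hp hζ
      (a := fun i ↦ algebraMap R (FractionRing R) (q i)) (fun i ↦ by simpa using (hq i).ne_zero) ht,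
    Finset.card_univ, Fintype.card_fin]
  intro s i hi c e
  have hndvd : ¬ q i ∣ ∏ j ∈ s, q j ^ e j := by
    rw [(hq i).dvd_finsetProd_iff]
    rintro ⟨j, hj, hdvd⟩
    have hassoc := (hq i).associated_of_dvd (hq j) ((hq i).dvd_of_dvd_pow hdvd)
    exact hdist i j (ne_of_mem_of_not_mem hj hi).symm
      (Ideal.span_singleton_eq_span_singleton.2 hassoc)
  simpa using (hq i).algebraMap_ne_pow_mul hndvd hp.two_le c
end

section
/- Let P be a finite partially ordered set equipped with a choice system, and let P' be a downward closed subset of P. If the choice system is smooth at every x ∈ P ∖ P', then there exists a positive integer n such that every fiber of the restriction map Γ(P) → Γ(P') has exactly n elements. -/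
universe u v

/-- A choice system on a poset `P`: a set `S x` for each `x : P` and a relation
`R` between `S x` and `S y` whenever `x ⊳ y` (i.e. `y ⋖ x`). -/
structure ChoiceSystem (P : Type u) [PartialOrder P] where
  S : P → Type v
  R : ∀ ⦃x y : P⦄, y ⋖ x → S x → S y → Prop

/-- The set of partial choices on a subset `P'` of `P`. -/
def ChoiceSystem.Gamma {P : Type u} [PartialOrder P] (C : ChoiceSystem P) (P' : Set P) :=
  { f : ∀ x ∈ P', C.S x //
    ∀ (x : P) (hx : x ∈ P') (y : P) (hy : y ∈ P') (h : y ⋖ x), C.R h (f x hx) (f y hy) }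

/-- The restriction map between sets of partial choices. -/
def ChoiceSystem.res {P : Type u} [PartialOrder P] (C : ChoiceSystem P) {P' P'' : Set P}
    (h : P'' ⊆ P') (f : C.Gamma P') : C.Gamma P'' :=
  ⟨fun x hx => f.1 x (h hx), fun x hx y hy hc => f.2 x (h hx) y (h hy) hc⟩

/-- Smoothness of a choice system at a point `x`: there is a positive integer `n` such
that for every downward closed subset `P''` containing `x` as a maximal element, every
fiber of the restriction map `Γ(P'') → Γ(P'' \ {x})` has exactly `n` elements. -/
def ChoiceSystem.SmoothAt {P : Type u} [PartialOrder P] (C : ChoiceSystem P) (x : P) :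
    Prop :=
  ∃ n : ℕ, 0 < n ∧ ∀ P'' : Set P, IsLowerSet P'' → x ∈ P'' → (∀ y ∈ P'', ¬ x < y) →
    ∀ g : C.Gamma (P'' \ {x}),
      Nat.card {f : C.Gamma P'' // C.res Set.diff_subset f = g} = n

/-- If all fibers of `φ` have `m > 0` elements and a fiber of `ψ` has `n` elements, then the
corresponding fiber of `ψ ∘ φ` has `n * m` elements. -/
theorem Nat.card_fiber_comp {α β γ : Type*} (φ : α → β) (ψ : β → γ) {m : ℕ} (hm : 0 < m)
    (hφ : ∀ b, Nat.card {a // φ a = b} = m) (c : γ) :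
    Nat.card {a // ψ (φ a) = c} = Nat.card {b // ψ b = c} * m := by
  have e (b : β) : Nonempty ({a // φ a = b} ≃ Fin m) := by
    have : Finite {a // φ a = b} := Nat.finite_of_card_ne_zero (by rw [hφ]; exact hm.ne')
    exact ⟨Finite.equivFinOfCardEq (hφ b)⟩
  let e₁ : {a // ψ (φ a) = c} ≃ Σ b : {b // ψ b = c}, {a // φ a = b.1} :=
    { toFun := fun a => ⟨⟨φ a.1, a.2⟩, ⟨a.1, rfl⟩⟩
      invFun := fun p => ⟨p.2.1, by rw [p.2.2]; exact p.1.2⟩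
      left_inv := fun _ => rfl
      right_inv := by rintro ⟨⟨b, hb⟩, ⟨a, ha⟩⟩; dsimp only at ha; subst ha; rfl }
  let e₂ : (Σ b : {b // ψ b = c}, {a // φ a = b.1}) ≃ {b // ψ b = c} × Fin m :=
    (Equiv.sigmaCongrRight fun b : {b // ψ b = c} => (e b.1).some).trans (Equiv.sigmaEquivProd _ _)
  rw [Nat.card_congr (e₁.trans e₂), Nat.card_prod, Nat.card_fin]

/-- The fibers of the restriction map between the partial choices on two nested lower sets all
have the same positive number of elements if the system is smooth on their difference. -/
theorem ChoiceSystem.exists_card_fiber_res {P : Type u} [PartialOrder P] [Finite P]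
    (C : ChoiceSystem.{u, v} P) {P' Q : Set P} (hP' : IsLowerSet P') (hQ : IsLowerSet Q)
    (hPQ : P' ⊆ Q) (hsmooth : ∀ x ∈ Q \ P', C.SmoothAt x) :
    ∃ n : ℕ, 0 < n ∧ ∀ g : C.Gamma P', Nat.card {f : C.Gamma Q // C.res hPQ f = g} = n := by
  induction hk : (Q \ P').ncard generalizing Q with
  | zero =>
    have hQP : Q ⊆ P' := by
      rwa [Set.ncard_eq_zero (Set.toFinite _), Set.sdiff_eq_empty] at hk
    obtain rfl := hPQ.antisymm hQP
    exact ⟨1, one_pos, fun g => Nat.card_unique (α := {f : C.Gamma P' // f = g})⟩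
  | succ k ih =>
    have hne : (Q \ P').Nonempty := by
      rw [← Set.ncard_pos (Set.toFinite _)]; lia
    obtain ⟨x, hx⟩ := (Set.toFinite (Q \ P')).exists_maximal hne
    have hmax : ∀ y ∈ Q, ¬ x < y := fun y hy hxy =>
      hx.not_gt ⟨hy, fun hy' => hx.prop.2 (hP' hxy.le hy')⟩ hxy
    have hlower : IsLowerSet (Q \ {x}) := fun a b hba ha =>
      ⟨hQ hba ha.1, fun hbx => hmax a ha.1 (lt_of_le_of_ne (hbx ▸ hba) (Ne.symm ha.2))⟩
    have hsub : P' ⊆ Q \ {x} := Set.subset_sdiff_singleton hPQ hx.prop.2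
    have hcard : ((Q \ {x}) \ P').ncard = k := by
      rw [Set.sdiff_sdiff_comm, Set.ncard_sdiff_singleton_of_mem hx.prop, hk, Nat.add_sub_cancel]
    obtain ⟨n, hn, hfib⟩ := ih hlower hsub (fun y hy => hsmooth y ⟨hy.1.1, hy.2⟩) hcard
    obtain ⟨m, hm, hxfib⟩ := hsmooth x hx.prop
    refine ⟨n * m, Nat.mul_pos hn hm, fun g => ?_⟩
    rw [← hfib g]
    exact Nat.card_fiber_comp (C.res Set.sdiff_subset) (C.res hsub) hm
      (hxfib Q hQ hx.prop.1 hmax) g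

/-- If a choice system on a finite poset `P` is smooth at every point
outside a downward closed subset `P'`, then all fibers of the restriction map
`Γ(P) → Γ(P')` have the same positive finite number of elements. -/
theorem stmt19 {P : Type u} [PartialOrder P] [Fintype P] (C : ChoiceSystem.{u, v} P)
    (P' : Set P) (hP' : IsLowerSet P')
    (hsmooth : ∀ x : P, x ∉ P' → C.SmoothAt x) :
    ∃ n : ℕ, 0 < n ∧ ∀ g : C.Gamma P',
      Nat.card {f : C.Gamma Set.univ // C.res (Set.subset_univ P') f = g} = n :=
  C.exists_card_fiber_res hP' isLowerSet_univ (Set.subset_univ P') fun x hx => hsmooth x hx.2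
end
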